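/- arXiv:2011.02244 — 5 statements merged into one kernel-verified Lean document; each statement's English description precedes it below -/
import Mathlib

section
/- Let p, q ∈ ℤ² with p∧q ≠ 0 and suppose q is of type I₀ relative to p. Then there exists ν₀ > 0 such that for every ν ∈ (0, ν₀) there exist a real number λ > 0 and a sequence w : ℤ → ℝ, not identically zero, which belongs to ℓ²_s(ℤ) for every s ≥ 0 and satisfies, for every n ∈ ℤ, the linearized Navier–Stokes eigenvalue recurrence ρ_{n−1} w_{n−1} − ρ_{n+1} w_{n+1} − ν‖q+np‖² w_n = λ w_n. In particular, the linearized operator L_{B,q} about the unidirectional steady state has a positive eigenvalue. -/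
open Filter Finset Topology

noncomputable section

/-- Squared Euclidean norm of an integer vector. -/
def nsq (v : ℤ × ℤ) : ℝ := (v.1 : ℝ) ^ 2 + (v.2 : ℝ) ^ 2

/-- Wedge (cross) product of two integer vectors. -/
def wedge (p q : ℤ × ℤ) : ℤ := p.1 * q.2 - p.2 * q.1

/-- The lattice point `q + n • p`. -/
def pt (q p : ℤ × ℤ) (n : ℤ) : ℤ × ℤ := (q.1 + n * p.1, q.2 + n * p.2)

/-- ρ_n = 1 - ‖p‖²/‖q+np‖². -/
def rho (p q : ℤ × ℤ) (n : ℤ) : ℝ := 1 - nsq p / nsq (pt q p n)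

/-- `q` is of type I₀ relative to `p`. -/
def typeI0 (p q : ℤ × ℤ) : Prop :=
  nsq q < nsq p ∧ ∀ n : ℤ, n ≠ 0 → nsq p < nsq (pt q p n)

/-- a_n(λ,ν) = (λ + ν‖q+np‖²)/ρ_n. -/
def acoef (p q : ℤ × ℤ) (lam ν : ℝ) (n : ℤ) : ℝ :=
  (lam + ν * nsq (pt q p n)) / rho p q n

/-- Membership in the weighted space ℓ²_s(ℤ). -/
def memL2s (s : ℝ) (w : ℤ → ℝ) : Prop :=
  Summable fun n : ℤ => (1 + |(n : ℝ)| ^ (2 * s)) * (w n) ^ 2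

/-- Finite continued fraction `[x₁; x₂; …; x_k] = 1/(x₁ + 1/(x₂ + ⋯ + 1/x_k))`. -/
def cfL : List ℝ → ℝ
  | [] => 0
  | x :: xs => 1 / (x + cfL xs)

def RR (a : ℕ → ℝ) : ℕ → ℕ → ℝ
  | 0, _ => 0
  | d + 1, n => 1 / (a n + RR a d (n + 1))

lemma RR_nonneg (a : ℕ → ℝ) (ha : ∀ n, 0 < a n) (d : ℕ) : ∀ n, 0 ≤ RR a d n := by
  induction d with
  | zero => intro n; simp [RR]
  | succ d ih =>
    intro n
    have h1 := ih (n + 1)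
    have h2 := ha n
    simp only [RR]
    positivity

lemma RR_le (a : ℕ → ℝ) (l : ℝ) (hl : 0 < l) (ha : ∀ n, l ≤ a n) (d : ℕ) (n : ℕ) :
    RR a d n ≤ 1 / l := by
  cases d with
  | zero => simp only [RR]; positivity
  | succ d =>
    have h1 := RR_nonneg a (fun n => lt_of_lt_of_le hl (ha n)) d (n + 1)
    simp only [RR]
    apply one_div_le_one_div_of_le hl
    linarith [ha n]

lemma RR_cont (a : ℝ → ℕ → ℝ) (S : Set ℝ) (ha : ∀ x ∈ S, ∀ n, 0 < a x n)
    (hc : ∀ n, ContinuousOn (fun x => a x n) S) (d : ℕ) :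
    ∀ n, ContinuousOn (fun x => RR (a x) d n) S := by
  induction d with
  | zero => intro n; simp only [RR]; exact continuousOn_const
  | succ d ih =>
    intro n
    simp only [RR]
    refine ContinuousOn.div continuousOn_const ((hc n).add (ih (n + 1))) ?_
    intro x hx
    have h1 := RR_nonneg (a x) (ha x hx) d (n + 1)
    have h2 := ha x hx n
    positivity

lemma RR_eq (a : ℕ → ℝ) (ha : ∀ n, 0 < a n) (N n : ℕ) (h : n < N) :
    RR a (N - n) n * (a n + RR a (N - (n + 1)) (n + 1)) = 1 := by
  obtain ⟨d, hd⟩ : ∃ d, N - n = d + 1 := ⟨N - n - 1, by omega⟩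
  have hd' : N - (n + 1) = d := by omega
  rw [hd, hd']
  have h1 := RR_nonneg a ha d (n + 1)
  have h2 := ha n
  simp only [RR]
  field_simp

lemma lower_bd (a r : ℕ → ℝ) (l ε : ℝ) (K : ℕ) (hl : 0 < l) (hε : 0 < ε)
    (hr : ∀ n, 0 ≤ r n) (he : ∀ n < 2 * K, r n * (a n + r (n + 1)) = 1)
    (h1 : ∀ n < 2 * K, l ≤ a n) (h2 : ∀ n < 2 * K, a n ≤ ε)
    (hs : ε * l * ((1 + K / 2) * ((K + 1) / 2)) ≤ 1 / 2) : K * l / 2 ≤ r 0 := by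
  have key : ∀ j : ℕ, j ≤ K → j * l / 2 ≤ r (2 * (K - j)) := by
    intro j
    induction j with
    | zero => intro _; simpa using hr _
    | succ j ih =>
      intro hj
      have ih' := ih (by omega)
      obtain ⟨m, hm⟩ : ∃ m, m = 2 * (K - (j + 1)) := ⟨_, rfl⟩
      have hm2 : 2 * (K - j) = m + 2 := by omega
      rw [hm2] at ih'
      rw [← hm]
      have e1 := he m (by omega)
      have e2 := he (m + 1) (by omega)
      have b1 := h2 m (by omega)
      have b2 := h1 (m + 1) (by omega)
      have x0 := hr m
      have y0 := hr (m + 1)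
      have hjK : (j : ℝ) ≤ K := by exact_mod_cast (by omega : j ≤ K)
      have hj0 : (0 : ℝ) ≤ j := by positivity
      generalize r m = x at *
      have e2' : r (m + 1) * (a (m + 1) + r (m + 2)) = 1 := e2
      generalize r (m + 1) = y at *
      generalize r (m + 2) = v at *
      by_contra! hlt
      push_cast at hlt
      set t : ℝ := (j + 1) * l / 2 with ht
      have ht0 : 0 < t := by positivity
      set u : ℝ := l * (1 + j / 2) with hu
      have hu0 : 0 < u := by positivity
      have yu : y * u ≤ 1 := by
        rw [← e2']
        apply mul_le_mul_of_nonneg_left _ y0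
        rw [hu]; linarith
      have A1 : 1 ≤ x * (ε + y) := by
        rw [← e1]
        exact mul_le_mul_of_nonneg_left (by linarith) x0
      have A2 : x * (ε + y) < t * (ε + y) := by
        apply mul_lt_mul_of_pos_right hlt; linarith
      have A3 : u < t * ε * u + t := by
        have : 1 * u < t * (ε + y) * u := mul_lt_mul_of_pos_right (by linarith) hu0
        nlinarith [mul_le_mul_of_nonneg_left yu ht0.le]
      have A4 : (1 + (j : ℝ) / 2) * ((j + 1) / 2) ≤ (1 + (K : ℝ) / 2) * ((K + 1) / 2) := by
        gcongr
      have A5 : ε * l * ((1 + (j : ℝ) / 2) * ((j + 1) / 2)) ≤ 1 / 2 :=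
        le_trans (mul_le_mul_of_nonneg_left A4 (by positivity)) hs
      have A6 : t * ε * u = l * (ε * l * ((1 + (j : ℝ) / 2) * ((j + 1) / 2))) := by
        rw [ht, hu]; ring
      have A7 : u = t + l / 2 := by rw [ht, hu]; ring
      have := mul_le_mul_of_nonneg_left A5 hl.le
      linarith
  have := key K le_rfl
  simpa using this

/-- Solutions of the two-sided continued fraction problem. -/
lemma exist_cf (b ρ : ℤ → ℝ) (δ : ℝ) (hb : ∀ n, 0 < b n) (h0 : ρ 0 < 0) (hδ : 0 < δ)
    (hρ : ∀ n, n ≠ 0 → δ ≤ ρ n ∧ ρ n ≤ 1) :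
    ∃ ν₀ > (0 : ℝ), ∀ ν : ℝ, 0 < ν → ν < ν₀ → ∃ lam > (0 : ℝ), ∃ r s : ℕ → ℝ,
      (∀ n, 0 ≤ r n) ∧ (∀ n, 0 ≤ s n) ∧
      (∀ n : ℕ, r n * ((lam + ν * b (n + 1)) / ρ (n + 1) + r (n + 1)) = 1) ∧
      (∀ n : ℕ, s n * ((lam + ν * b (-(n + 1))) / ρ (-(n + 1)) + s (n + 1)) = 1) ∧
      r 0 + s 0 = (lam + ν * b 0) / (-ρ 0) := by
  obtain ⟨K, hK⟩ := exists_nat_gt (4 / (-ρ 0))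
  have hρ0 : 0 < -ρ 0 := by linarith
  set Q : ℝ := (1 + K / 2) * ((K + 1) / 2) with hQ
  have hQ0 : 0 < Q := by positivity
  -- choose l
  set l : ℝ := min 1 (δ / (4 * Q)) with hl
  have hl0 : 0 < l := by rw [hl]; positivity
  have hl1 : l ≤ 1 := min_le_left _ _
  have hl2 : l * (4 * Q) ≤ δ := by
    rw [← le_div_iff₀ (by positivity)]; exact min_le_right _ _
  have hs : (2 * l / δ) * l * Q ≤ 1 / 2 := by
    have : (2 * l / δ) * l * Q = (l * (l * (4 * Q))) / (2 * δ) := by field_simp; ring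
    rw [this, div_le_iff₀ (by positivity)]
    nlinarith
  set B : ℝ := ∑ n ∈ Finset.range (2 * K + 1), b n with hB
  have hBn : ∀ n : ℕ, n ≤ 2 * K → b n ≤ B := fun n hn =>
    Finset.single_le_sum (f := fun n : ℕ => b n) (fun i _ => (hb i).le)
      (Finset.mem_range.2 (by omega))
  have hB0 : 0 < B := lt_of_lt_of_le (hb 0) (by simpa using hBn 0 (by omega))
  refine ⟨l / B, by positivity, fun ν hν hνl => ?_⟩
  have hνB : ν * B < l := by rwa [lt_div_iff₀ hB0] at hνl
  have hνb : ∀ n : ℕ, n ≤ 2 * K → ν * b n ≤ l := fun n hn =>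
    le_trans (mul_le_mul_of_nonneg_left (hBn n hn) hν.le) hνB.le
  set ap : ℝ → ℕ → ℝ := fun x n => (x + ν * b (n + 1)) / ρ (n + 1) with hap
  set am : ℝ → ℕ → ℝ := fun x n => (x + ν * b (-(n + 1))) / ρ (-(n + 1)) with ham
  have gen : ∀ x : ℝ, 0 < x → ∀ n : ℤ, n ≠ 0 → x ≤ (x + ν * b n) / ρ n := by
    intro x hx n hn
    obtain ⟨h1, h2⟩ := hρ n hn
    rw [le_div_iff₀ (by linarith)]
    have := mul_pos hν (hb n)
    nlinarith
  have hap1 : ∀ x, 0 < x → ∀ n, x ≤ ap x n := fun x hx n => gen x hx _ (by omega)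
  have ham1 : ∀ x, 0 < x → ∀ n, x ≤ am x n := fun x hx n => gen x hx _ (by omega)
  have hapc : ∀ n, Continuous fun x => ap x n := fun n => by
    simp only [hap]; fun_prop
  have hamc : ∀ n, Continuous fun x => am x n := fun n => by
    simp only [ham]; fun_prop
  set Λ : ℝ := l + 2 * (-ρ 0) + 1 with hΛ
  have hlΛ : l ≤ Λ := by linarith
  have hΛ0 : 0 < Λ := by linarith
  have hposp : ∀ x ∈ Set.Icc l Λ, ∀ n, 0 < ap x n := fun x hx n =>
    lt_of_lt_of_le (by linarith [hx.1]) (hap1 x (by linarith [hx.1]) n)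
  have hposm : ∀ x ∈ Set.Icc l Λ, ∀ n, 0 < am x n := fun x hx n =>
    lt_of_lt_of_le (by linarith [hx.1]) (ham1 x (by linarith [hx.1]) n)
  -- truncated solutions
  have trunc : ∀ N : ℕ, ∃ x ∈ Set.Icc l Λ,
      RR (ap x) (N + 2 * K) 0 + RR (am x) (N + 2 * K) 0 = (x + ν * b 0) / (-ρ 0) := by
    intro N
    have hc : ContinuousOn (fun x => RR (ap x) (N + 2 * K) 0 + RR (am x) (N + 2 * K) 0
        - (x + ν * b 0) / (-ρ 0)) (Set.Icc l Λ) := by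
      refine ContinuousOn.sub (ContinuousOn.add ?_ ?_) ?_
      · exact RR_cont ap _ hposp (fun n => (hapc n).continuousOn) _ _
      · exact RR_cont am _ hposm (fun n => (hamc n).continuousOn) _ _
      · fun_prop
    have hmem : (0 : ℝ) ∈ Set.Icc
        (RR (ap Λ) (N + 2 * K) 0 + RR (am Λ) (N + 2 * K) 0 - (Λ + ν * b 0) / (-ρ 0))
        (RR (ap l) (N + 2 * K) 0 + RR (am l) (N + 2 * K) 0 - (l + ν * b 0) / (-ρ 0)) := by
      constructor
      · have i1 := RR_le (ap Λ) Λ hΛ0 (hap1 Λ hΛ0) (N + 2 * K) 0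
        have i2 := RR_le (am Λ) Λ hΛ0 (ham1 Λ hΛ0) (N + 2 * K) 0
        have i3 : 2 * (1 / Λ) ≤ (Λ + ν * b 0) / (-ρ 0) := by
          rw [le_div_iff₀ hρ0, ← mul_le_mul_iff_left₀ hΛ0]
          have := mul_pos hν (hb 0)
          have e : 2 * (1 / Λ) * -ρ 0 * Λ = 2 * -ρ 0 := by field_simp
          rw [e]
          nlinarith
        linarith
      · have i1 := lower_bd (ap l) (fun n => RR (ap l) (N + 2 * K - n) n) l (2 * l / δ) K hl0
          (by positivity)
          (fun n => RR_nonneg _ (hposp l ⟨le_rfl, hlΛ⟩) _ _)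
          (fun n hn => RR_eq _ (hposp l ⟨le_rfl, hlΛ⟩) _ _ (by omega))
          (fun n _ => hap1 l hl0 n)
          (fun n hn => by
            have h := hνb (n + 1) (by omega)
            push_cast at h
            have h1 := (hρ (n + 1) (by omega)).1
            simp only [hap]
            apply div_le_div₀ (by positivity) (by linarith) hδ h1)
          hs
        simp only [Nat.sub_zero] at i1
        have i2 := RR_nonneg (am l) (hposm l ⟨le_rfl, hlΛ⟩) (N + 2 * K) 0
        have i3 : (l + ν * b 0) / (-ρ 0) ≤ K * l / 2 := by
          rw [div_le_iff₀ hρ0]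
          rw [div_lt_iff₀ hρ0] at hK
          have := hνb 0 (by omega)
          push_cast at this
          nlinarith
        linarith
    obtain ⟨x, hx, hx2⟩ := intermediate_value_Icc' hlΛ hc hmem
    exact ⟨x, hx, by simpa [sub_eq_zero] using hx2⟩
  choose X hX hXe using trunc
  set u : ℕ → ℝ × (ℕ → ℝ) × (ℕ → ℝ) := fun N =>
    (X N, fun n => RR (ap (X N)) (N + 2 * K - n) n, fun n => RR (am (X N)) (N + 2 * K - n) n)
    with hu
  have hcomp : IsCompact (Set.Icc l Λ ×ˢ ((Set.pi Set.univ fun _ : ℕ => Set.Icc (0 : ℝ) (1 / l)) ×ˢ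
      (Set.pi Set.univ fun _ : ℕ => Set.Icc (0 : ℝ) (1 / l)))) :=
    isCompact_Icc.prod ((isCompact_univ_pi fun _ => isCompact_Icc).prod
      (isCompact_univ_pi fun _ => isCompact_Icc))
  have hXl : ∀ N, 0 < X N := fun N => lt_of_lt_of_le hl0 (hX N).1
  have humem : ∀ N, u N ∈ (Set.Icc l Λ ×ˢ ((Set.pi Set.univ fun _ : ℕ => Set.Icc (0 : ℝ) (1 / l)) ×ˢ
      (Set.pi Set.univ fun _ : ℕ => Set.Icc (0 : ℝ) (1 / l)))) := by
    intro N
    refine ⟨hX N, ?_, ?_⟩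
    · intro n _
      exact ⟨RR_nonneg _ (hposp _ (hX N)) _ _,
        RR_le _ l hl0 (fun n => (hX N).1.trans (hap1 _ (hXl N) n)) _ _⟩
    · intro n _
      exact ⟨RR_nonneg _ (hposm _ (hX N)) _ _,
        RR_le _ l hl0 (fun n => (hX N).1.trans (ham1 _ (hXl N) n)) _ _⟩
  obtain ⟨⟨x, r, s⟩, hmem, φ, hφ, hlim⟩ := hcomp.tendsto_subseq humem
  obtain ⟨hx, hr, hs'⟩ := hmem
  have hlx : Tendsto (fun N => X (φ N)) atTop (𝓝 x) := (continuous_fst.tendsto _).comp hlim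
  have hlr : ∀ n, Tendsto (fun N => RR (ap (X (φ N))) (φ N + 2 * K - n) n) atTop (𝓝 (r n)) :=
    fun n => (((continuous_apply n).comp (continuous_fst.comp continuous_snd)).tendsto
      (x, r, s)).comp hlim
  have hls : ∀ n, Tendsto (fun N => RR (am (X (φ N))) (φ N + 2 * K - n) n) atTop (𝓝 (s n)) :=
    fun n => (((continuous_apply n).comp (continuous_snd.comp continuous_snd)).tendsto
      (x, r, s)).comp hlim
  have hx0 : 0 < x := lt_of_lt_of_le hl0 hx.1
  have hbig : ∀ n, ∀ᶠ N in atTop, n < φ N + 2 * K := fun n => by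
    filter_upwards [eventually_gt_atTop n] with N hN
    have := hφ.id_le N
    simp only [id] at this
    omega
  refine ⟨x, hx0, r, s, fun n => (hr n trivial).1, fun n => (hs' n trivial).1, ?_, ?_, ?_⟩
  · intro n
    have t1 := (hlr n).mul ((((hapc n).tendsto x).comp hlx).add (hlr (n + 1)))
    refine tendsto_nhds_unique (t1.congr' ?_) (tendsto_const_nhds (x := (1 : ℝ)))
    filter_upwards [hbig n] with N hN
    exact RR_eq _ (hposp _ (hX _)) _ _ hN
  · intro n
    have t1 := (hls n).mul ((((hamc n).tendsto x).comp hlx).add (hls (n + 1)))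
    refine tendsto_nhds_unique (t1.congr' ?_) (tendsto_const_nhds (x := (1 : ℝ)))
    filter_upwards [hbig n] with N hN
    exact RR_eq _ (hposm _ (hX _)) _ _ hN
  · have t1 := (hlr 0).add (hls 0)
    have t2 : Tendsto (fun N => (X (φ N) + ν * b 0) / (-ρ 0)) atTop
        (𝓝 ((x + ν * b 0) / (-ρ 0))) := (hlx.add_const _).div_const _
    refine tendsto_nhds_unique (t1.congr ?_) t2
    intro N
    exact hXe (φ N)

/-- The product sequence. -/
def zz (r : ℕ → ℝ) : ℕ → ℝ
  | 0 => 1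
  | n + 1 => r n * zz r n

lemma zz_decay (r : ℕ → ℝ) (N : ℕ) (hr : ∀ n, 0 ≤ r n) (h : ∀ n ≥ N, r n ≤ 1 / 2) :
    ∃ C : ℝ, ∀ n ≥ N, (zz r n) ^ 2 ≤ C * (1 / 4) ^ n := by
  refine ⟨(zz r N) ^ 2 * 4 ^ N, fun n hn => ?_⟩
  induction n, hn using Nat.le_induction with
  | base => rw [mul_assoc, ← mul_pow]; norm_num
  | succ n hn ih =>
    simp only [zz]
    rw [mul_pow, pow_succ (1 / 4 : ℝ) n]
    have : (r n) ^ 2 ≤ 1 / 4 := by nlinarith [hr n, h n hn]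
    nlinarith [sq_nonneg (zz r n), sq_nonneg (r n)]

lemma sum_decay (f : ℕ → ℝ) (N : ℕ) (C s : ℝ) (hs : 0 ≤ s)
    (h : ∀ n ≥ N, (f n) ^ 2 ≤ C * (1 / 4) ^ n) :
    Summable fun n : ℕ => (1 + |(n : ℝ)| ^ (2 * s)) * (f n) ^ 2 := by
  obtain ⟨k, hk⟩ := exists_nat_ge (2 * s)
  have h1 : Summable fun n : ℕ => ((n : ℝ) ^ k) * (1 / 4 : ℝ) ^ n :=
    summable_pow_mul_geometric_of_norm_lt_one k (by norm_num)
  have h2 : Summable fun n : ℕ => (((n + 1 : ℕ) : ℝ) ^ k) * (1 / 4 : ℝ) ^ (n + 1) :=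
    (summable_nat_add_iff 1).2 h1
  refine summable_of_isBigO_nat (h2.mul_left (2 * C * 4)) ?_
  apply Asymptotics.IsBigO.of_bound 1
  filter_upwards [eventually_ge_atTop N] with n hn
  have e1 : |(n : ℝ)| ^ (2 * s) ≤ ((n : ℝ) + 1) ^ k := by
    rw [abs_of_nonneg (by positivity), ← Real.rpow_natCast]
    calc (n : ℝ) ^ (2 * s) ≤ ((n : ℝ) + 1) ^ (2 * s) :=
          Real.rpow_le_rpow (by positivity) (by linarith) (by linarith)
      _ ≤ _ := Real.rpow_le_rpow_of_exponent_le (by linarith [(n.cast_nonneg : (0 : ℝ) ≤ n)]) hk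
  have e2 : (1 : ℝ) ≤ ((n : ℝ) + 1) ^ k := one_le_pow₀ (by linarith [(n.cast_nonneg : (0 : ℝ) ≤ n)])
  have e3 := h n hn
  have e4 : 0 ≤ |(n : ℝ)| ^ (2 * s) := by positivity
  rw [Real.norm_of_nonneg (by positivity), one_mul]
  refine le_trans ?_ (le_abs_self _)
  push_cast
  calc (1 + |(n : ℝ)| ^ (2 * s)) * (f n) ^ 2 ≤ (2 * ((n : ℝ) + 1) ^ k) * (C * (1 / 4) ^ n) :=
        mul_le_mul (by linarith) e3 (by positivity) (by positivity)
    _ = _ := by rw [pow_succ]; ring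

/-- Instability of unidirectional flows for 2D Navier-Stokes: if `q` is of type I₀
relative to `p`, then for all sufficiently small viscosity `ν > 0` the linearized
operator `L_{B,q}` has a positive eigenvalue `λ` with eigenvector in ℓ²_s(ℤ) for
every `s ≥ 0`. -/
theorem instability_NavierStokes_typeI0 (p q : ℤ × ℤ) (hpq : wedge p q ≠ 0)
    (hI0 : typeI0 p q) :
    ∃ ν₀ > (0 : ℝ), ∀ ν : ℝ, 0 < ν → ν < ν₀ →
      ∃ lam > (0 : ℝ), ∃ w : ℤ → ℝ, w ≠ 0 ∧ (∀ s : ℝ, 0 ≤ s → memL2s s w) ∧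
        ∀ n : ℤ, rho p q (n - 1) * w (n - 1) - rho p q (n + 1) * w (n + 1)
          - ν * nsq (pt q p n) * w n = lam * w n := by
  obtain ⟨hq, hn⟩ := hI0
  have hint : ∀ v : ℤ × ℤ, nsq v = ((v.1 ^ 2 + v.2 ^ 2 : ℤ) : ℝ) := fun v => by
    simp [nsq]
  have hlt : ∀ v v' : ℤ × ℤ, nsq v < nsq v' → nsq v + 1 ≤ nsq v' := by
    intro v v' h
    rw [hint, hint] at *
    exact_mod_cast h
  have hpos : ∀ n, 0 < nsq (pt q p n) := by
    intro n
    rw [hint]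
    have : 0 < (pt q p n).1 ^ 2 + (pt q p n).2 ^ 2 := by
      by_contra! h
      have a1 : (pt q p n).1 = 0 := by nlinarith [sq_nonneg (pt q p n).1, sq_nonneg (pt q p n).2]
      have a2 : (pt q p n).2 = 0 := by nlinarith [sq_nonneg (pt q p n).1, sq_nonneg (pt q p n).2]
      apply hpq
      simp only [pt, wedge] at *
      linear_combination p.1 * a2 - p.2 * a1
    exact_mod_cast this
  have hpt0 : pt q p 0 = q := by simp [pt]
  have hq0 : 0 < nsq q := by simpa [hpt0] using hpos 0
  have hP1 : 1 < nsq p := by linarith [hlt _ _ hq]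
  have hρ0 : rho p q 0 < 0 := by
    simp only [rho, hpt0]
    rw [sub_neg, lt_div_iff₀ hq0]; linarith
  set δ : ℝ := 1 / (nsq p + 1) with hδ
  have hδ0 : 0 < δ := by positivity
  have hρ : ∀ n, n ≠ 0 → δ ≤ rho p q n ∧ rho p q n ≤ 1 := by
    intro n h
    have h1 := hlt _ _ (hn n h)
    have h2 := hpos n
    constructor
    · have : nsq p / nsq (pt q p n) ≤ nsq p / (nsq p + 1) := by gcongr
      have e : δ = 1 - nsq p / (nsq p + 1) := by rw [hδ]; field_simp; ring
      rw [e]; simp only [rho]; linarith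
    · have : 0 ≤ nsq p / nsq (pt q p n) := by positivity
      simp only [rho]; linarith
  have hne : ∀ n, rho p q n ≠ 0 := by
    intro n
    by_cases h : n = 0
    · rw [h]; exact hρ0.ne
    · exact (lt_of_lt_of_le hδ0 (hρ n h).1).ne'
  obtain ⟨ν₀, hν₀, H⟩ := exist_cf (fun n => nsq (pt q p n)) (rho p q) δ hpos hρ0 hδ0 hρ
  refine ⟨ν₀, hν₀, fun ν hν hν1 => ?_⟩
  obtain ⟨lam, hlam, r, s, hr, hs, her, hes, h0⟩ := H ν hν hν1
  refine ⟨lam, hlam, ?_⟩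
  -- growth
  have hgrow : ∀ n : ℤ, (n : ℝ) ^ 2 / 2 - 1 ≤ nsq (pt q p n) / nsq p := by
    intro n
    rw [le_div_iff₀ (by linarith)]
    simp only [nsq, pt] at *
    push_cast
    nlinarith [sq_nonneg (2 * (q.1 : ℝ) + n * p.1), sq_nonneg (2 * (q.2 : ℝ) + n * p.2)]
  have hgrow2 : ∀ n : ℤ, (n : ℝ) ^ 2 / 2 - 1 ≤ nsq (pt q p n) := by
    intro n
    refine (hgrow n).trans (div_le_self (hpos n).le hP1.le)
  obtain ⟨N, hN⟩ := exists_nat_gt (2 / ν + 2)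
  have hν2 : 0 < 2 / ν := by positivity
  have small : ∀ n : ℕ, n ≥ N → ∀ m : ℤ, (m : ℝ) ^ 2 = ((n : ℝ) + 1) ^ 2 → m ≠ 0 →
      ∀ x y : ℝ, 0 ≤ x → 0 ≤ y → x * ((lam + ν * nsq (pt q p m)) / rho p q m + y) = 1 →
      x ≤ 1 / 2 := by
    intro n hnN m hm hm0 x y hx hy he
    have h1 := hgrow2 m
    rw [hm] at h1
    have hnN' : (N : ℝ) ≤ n := by exact_mod_cast hnN
    have h2 : 2 / ν ≤ nsq (pt q p m) := by nlinarith
    have h3 : 2 ≤ ν * nsq (pt q p m) := by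
      rw [div_le_iff₀ hν] at h2; linarith
    have h4 : 2 ≤ (lam + ν * nsq (pt q p m)) / rho p q m := by
      obtain ⟨i1, i2⟩ := hρ m hm0
      rw [le_div_iff₀ (by linarith)]
      linarith
    nlinarith
  have hrs : ∀ n ≥ N, r n ≤ 1 / 2 := fun n h =>
    small n h (n + 1) (by push_cast; ring) (by omega) _ _ (hr n) (hr (n + 1)) (her n)
  have hss : ∀ n ≥ N, s n ≤ 1 / 2 := fun n h =>
    small n h (-(n + 1)) (by push_cast; ring) (by omega) _ _ (hs n) (hs (n + 1)) (hes n)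
  obtain ⟨C1, hC1⟩ := zz_decay r N hr hrs
  obtain ⟨C2, hC2⟩ := zz_decay s N hs hss
  -- the solution
  set z : ℤ → ℝ := fun n => if 0 ≤ n then zz r n.toNat else (-1) ^ n.natAbs * zz s n.natAbs with hz
  have hzp : ∀ n : ℕ, z n = zz r n := fun n => by simp [hz]
  have hzm : ∀ n : ℕ, z (-n) = (-1) ^ n * zz s n := fun n => by
    rcases Nat.eq_zero_or_pos n with h | h
    · subst h; simp [hz, zz]
    · have : ¬ (0 : ℤ) ≤ -n := by omega
      simp only [hz]
      rw [if_neg this]; simp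
  have hzeq : ∀ n : ℤ, z (n - 1) - z (n + 1) = (lam + ν * nsq (pt q p n)) / rho p q n * z n := by
    intro n
    rcases lt_trichotomy n 0 with h | h | h
    · obtain ⟨m, rfl⟩ : ∃ m : ℕ, n = -((m : ℤ) + 1) := ⟨(-n - 1).toNat, by omega⟩
      have e1 : (-((m : ℤ) + 1) - 1) = -((m + 2 : ℕ) : ℤ) := by push_cast; ring
      have e2 : (-((m : ℤ) + 1) + 1) = -(m : ℤ) := by ring
      have e3 : z (-((m : ℤ) + 1)) = (-1) ^ (m + 1) * zz s (m + 1) := by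
        rw [← hzm]; push_cast; rfl
      rw [e1, e2, e3, hzm, hzm]
      have h := hes m
      simp only [zz, pow_succ]
      linear_combination ((-1) ^ m * zz s m) * h
    · subst h
      have e1 : z (0 - 1) = -s 0 := by
        have := hzm 1
        simpa [zz] using this
      have e2 : z (0 + 1) = r 0 := by
        have := hzp 1
        simpa [zz] using this
      have e3 : z 0 = 1 := by
        have := hzp 0
        simpa [zz] using this
      rw [e1, e2, e3]
      rw [div_neg] at h0
      linarith
    · obtain ⟨m, rfl⟩ : ∃ m : ℕ, n = (m : ℤ) + 1 := ⟨(n - 1).toNat, by omega⟩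
      have e1 : ((m : ℤ) + 1 - 1) = (m : ℤ) := by ring
      have e2 : ((m : ℤ) + 1 + 1) = ((m + 2 : ℕ) : ℤ) := by push_cast; ring
      have e3 : z ((m : ℤ) + 1) = zz r (m + 1) := by
        rw [← hzp]; push_cast; rfl
      rw [e1, e2, e3, hzp, hzp]
      have h := her m
      simp only [zz]
      linear_combination (- zz r m) * h
  refine ⟨fun n => z n / rho p q n, ?_, ?_, ?_⟩
  · intro h
    have h1 := congrFun h 0
    have e3 : z 0 = 1 := by
      have := hzp 0
      simpa [zz] using this
    simp only [e3, Pi.zero_apply] at h1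
    exact (one_div_ne_zero (hne 0)) h1
  · intro t ht
    have sq : ∀ m : ℤ, m ≠ 0 → ∀ c : ℝ, (z m) ^ 2 ≤ c →
        (z m / rho p q m) ^ 2 ≤ c / δ ^ 2 := by
      intro m hm c hc
      rw [div_pow]
      have := (hρ m hm).1
      have := hc.trans' (sq_nonneg (z m))
      gcongr
    unfold memL2s
    apply Summable.of_nat_of_neg
    · refine sum_decay (fun n => z n / rho p q n) (N + 1) (C1 / δ ^ 2) t ht ?_
      intro n hnN
      refine (sq n (by omega) (C1 * (1 / 4) ^ n) (by rw [hzp]; exact hC1 n (by omega))).trans (le_of_eq (by ring))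
    · have := sum_decay (fun n => z (-n) / rho p q (-n)) (N + 1) (C2 / δ ^ 2) t ht ?_
      · refine this.congr fun n => ?_
        push_cast
        rw [abs_neg]
      · intro n hnN
        refine (sq (-n) (by omega) (C2 * (1 / 4) ^ n) ?_).trans (le_of_eq (by ring))
        · rw [hzm, mul_pow, ← pow_mul, mul_comm n 2, pow_mul]
          simpa using hC2 n (by omega)
  · intro n
    have h1 := hzeq n
    simp only [mul_div_cancel₀ _ (hne (n - 1)), mul_div_cancel₀ _ (hne (n + 1))]
    rw [h1]
    ring
end
end

section
/- Let p, q ∈ ℤ² with p∧q ≠ 0 and suppose q is of type I₀ relative to p. Fix ν > 0 and λ > 0. Then the limits f(λ,ν) = lim_{k→∞}[a₁(λ,ν);…;a_k(λ,ν)] and g(λ,ν) = lim_{k→∞}[a_{−1}(λ,ν);…;a_{−k}(λ,ν)] exist, and the following are equivalent: (i) there is a sequence w:ℤ→ℝ belonging to ℓ²_s(ℤ) for every s ≥ 0, satisfying ρ_{n−1}w_{n−1} − ρ_{n+1}w_{n+1} − ν‖q+np‖² w_n = λ w_n for all n ∈ ℤ, and satisfying the I₀ sign property; (ii) a₀(λ,ν)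 + f(λ,ν) + g(λ,ν) = 0. -/
open Filter Finset Topology

noncomputable section

/-- The I₀ sign pattern for an eigenvector sequence. -/
def signI0 (w : ℤ → ℝ) : Prop :=
  (∀ n : ℤ, 1 ≤ n → 0 < w n) ∧ w (-1) < 0 ∧ w 0 < 0 ∧
    ∀ n : ℤ, n ≤ -2 → 0 < (-1 : ℝ) ^ n.natAbs * w n

/-- Truncated continued fraction with tail `x`. -/
def cfT : (ℕ → ℝ) → ℕ → ℝ → ℝ
  | _, 0, x => x
  | b, k + 1, x => 1 / (b 0 + cfT (fun n => b (n + 1)) k x)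

theorem cfL_eq_cfT (k : ℕ) : ∀ b : ℕ → ℝ, cfL ((List.range k).map b) = cfT b k 0 := by
  induction k with
  | zero => intro b; simp [cfL, cfT]
  | succ k ih =>
    intro b
    rw [List.range_succ_eq_map, List.map_cons, List.map_map, cfL, cfT, ← ih]
    rfl

theorem cfL_eq_cfT_cast (k : ℕ) (f : ℤ → ℝ) (l : List ℤ)
    (hl : l = (List.range k).map (fun a : ℕ => (a : ℤ))) :
    cfL (l.map f) = cfT (fun j : ℕ => f (j : ℤ)) k 0 := by
  rw [hl, List.map_map, ← cfL_eq_cfT]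
  rfl

theorem cfT_add (k : ℕ) : ∀ (b : ℕ → ℝ) (j : ℕ) (x : ℝ),
    cfT b (k + j) x = cfT b k (cfT (fun n => b (n + k)) j x) := by
  induction k with
  | zero => intro b j x; simp [cfT]
  | succ k ih =>
    intro b j x
    rw [show k + 1 + j = (k + j) + 1 by ring, cfT, cfT, ih]
    rfl

theorem cfT_nonneg (k : ℕ) : ∀ (b : ℕ → ℝ) (x : ℝ), (∀ n, 0 < b n) → 0 ≤ x → 0 ≤ cfT b k x := by
  induction k with
  | zero => intro b x _ hx; simpa [cfT] using hx
  | succ k ih =>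
    intro b x hb hx
    rw [cfT]
    have := ih (fun n => b (n + 1)) x (fun n => hb _) hx
    have := hb 0
    positivity

theorem cfT_le (c : ℝ) (hc : 0 < c) (k : ℕ) (b : ℕ → ℝ) (x : ℝ) (hb : ∀ n, c ≤ b n)
    (hx : 0 ≤ x) (hx' : x ≤ 1 / c) : cfT b k x ≤ 1 / c := by
  cases k with
  | zero => simpa [cfT] using hx'
  | succ k =>
    rw [cfT]
    have := cfT_nonneg k (fun n => b (n + 1)) x (fun n => hc.trans_le (hb _)) hx
    exact one_div_le_one_div_of_le hc (by linarith [hb 0])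

theorem two_step (c b b' u u' : ℝ) (hc : 0 < c) (hb : c ≤ b) (hb' : c ≤ b') (hu : 0 ≤ u)
    (hu' : 0 ≤ u') :
    |1 / (b + 1 / (b' + u)) - 1 / (b + 1 / (b' + u'))| ≤ (1 / (1 + c ^ 2)) * |u - u'| := by
  have h1 : 0 < b := hc.trans_le hb
  have h2 : 0 < b' := hc.trans_le hb'
  have h3 : 1 + c ^ 2 ≤ b * (b' + u) + 1 := by nlinarith [mul_le_mul hb hb' hc.le h1.le, mul_nonneg h1.le hu]
  have h4 : 1 ≤ b * (b' + u') + 1 := by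
    have : 0 ≤ b * (b' + u') := by positivity
    linarith
  have e : 1 / (b + 1 / (b' + u)) - 1 / (b + 1 / (b' + u')) =
      (u - u') / ((b * (b' + u) + 1) * (b * (b' + u') + 1)) := by
    field_simp
    ring
  have h5 : 1 + c ^ 2 ≤ (b * (b' + u) + 1) * (b * (b' + u') + 1) := by nlinarith [sq_nonneg c]
  have h6 : 0 < 1 + c ^ 2 := by positivity
  rw [e, abs_div, abs_of_pos (h6.trans_le h5), div_eq_mul_inv, mul_comm, one_div]
  gcongr

/-- contraction rate -/
def rr (c : ℝ) : ℝ := (Real.sqrt (1 + c ^ 2))⁻¹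

theorem rr_pos (c : ℝ) : 0 < rr c := by unfold rr; positivity
theorem rr_sq (c : ℝ) : rr c ^ 2 = 1 / (1 + c ^ 2) := by
  unfold rr; rw [inv_pow, Real.sq_sqrt (by positivity), one_div]
theorem rr_lt (c : ℝ) (hc : 0 < c) : rr c < 1 := by
  unfold rr
  apply inv_lt_one_of_one_lt₀
  rw [Real.lt_sqrt (by norm_num)]
  nlinarith [pow_pos hc 2]

theorem cfT_contr (c : ℝ) (hc : 0 < c) (k : ℕ) : ∀ (b : ℕ → ℝ) (x x' : ℝ), (∀ n, c ≤ b n) →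
    0 ≤ x → 0 ≤ x' →
    |cfT b k x - cfT b k x'| ≤ (1 + 1 / (c ^ 2 * rr c)) * rr c ^ k * |x - x'| := by
  have hr := rr_pos c
  induction k using Nat.twoStepInduction with
  | zero =>
    intro b x x' hb hx hx'
    simp only [cfT, pow_zero, mul_one]
    have : 0 ≤ 1 / (c ^ 2 * rr c) := by positivity
    nlinarith [abs_nonneg (x - x')]
  | one =>
    intro b x x' hb hx hx'
    simp only [cfT, pow_one]
    have h0 := hb 0
    have hb0 := hc.trans_le h0
    have e : 1 / (b 0 + x) - 1 / (b 0 + x') = (x' - x) / ((b 0 + x) * (b 0 + x')) := by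
      field_simp
      ring
    have h5 : c ^ 2 ≤ (b 0 + x) * (b 0 + x') := by nlinarith [mul_nonneg hx hx', mul_nonneg hb0.le hx, mul_nonneg hb0.le hx']
    have h6 : 0 < c ^ 2 := by positivity
    rw [e, abs_div, abs_of_pos (h6.trans_le h5), div_eq_mul_inv, mul_comm, abs_sub_comm]
    have e2 : (1 + 1 / (c ^ 2 * rr c)) * rr c = rr c + (c ^ 2)⁻¹ := by field_simp
    rw [e2]
    gcongr
    have := inv_anti₀ h6 h5
    linarith
  | more k ih _ =>
    intro b x x' hb hx hx'
    have hb' : ∀ n, c ≤ b (n + 1 + 1) := fun n => hb _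
    have hp : ∀ n, 0 < b (n + 1 + 1) := fun n => hc.trans_le (hb _)
    have := ih (fun n => b (n + 1 + 1)) x x' hb' hx hx'
    have h2 := two_step c (b 0) (b (0 + 1)) _ _ hc (hb _) (hb _) (cfT_nonneg k _ x hp hx)
      (cfT_nonneg k _ x' hp hx')
    simp only [cfT]
    refine h2.trans ?_
    rw [← rr_sq]
    calc _ ≤ rr c ^ 2 * ((1 + 1 / (c ^ 2 * rr c)) * rr c ^ k * |x - x'|) := by gcongr
      _ = _ := by ring

theorem rate_tendsto (c : ℝ) (hc : 0 < c) (A B : ℝ) :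
    Tendsto (fun k : ℕ => A * rr c ^ k * B) atTop (nhds 0) := by
  have := ((tendsto_pow_atTop_nhds_zero_of_lt_one (rr_pos c).le (rr_lt c hc)).const_mul A).mul_const B
  simpa using this

theorem cfT_conv (c : ℝ) (hc : 0 < c) (b : ℕ → ℝ) (hb : ∀ n, c ≤ b n) :
    ∃ L, Tendsto (fun k => cfT b k 0) atTop (nhds L) := by
  apply cauchySeq_tendsto_of_complete
  refine cauchySeq_of_le_tendsto_0' (fun k => (1 + 1 / (c ^ 2 * rr c)) * rr c ^ k * (1 / c)) ?_
    (rate_tendsto c hc _ _)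
  intro n m hnm
  obtain ⟨j, rfl⟩ := Nat.exists_eq_add_of_le hnm
  have h0 := cfT_nonneg j (fun i => b (i + n)) 0 (fun i => hc.trans_le (hb _)) le_rfl
  have h1 := cfT_le c hc j (fun i => b (i + n)) 0 (fun i => hb _) le_rfl (by positivity)
  rw [cfT_add, Real.dist_eq]
  refine (cfT_contr c hc n b _ _ hb le_rfl h0).trans ?_
  have := rr_pos c
  gcongr
  rw [zero_sub, abs_neg, abs_of_nonneg h0]
  exact h1

theorem cfT_unique (c : ℝ) (hc : 0 < c) (b : ℕ → ℝ) (hb : ∀ n, c ≤ b n) (L : ℝ)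
    (hL : Tendsto (fun k => cfT b k 0) atTop (nhds L)) (y : ℕ → ℝ) (hy : ∀ n, 0 < y n)
    (hrec : ∀ n, y n = b n * y (n + 1) + y (n + 2)) : y 1 = L * y 0 := by
  have key : ∀ k (b : ℕ → ℝ) (y : ℕ → ℝ), (∀ n, 0 < y n) →
      (∀ n, y n = b n * y (n + 1) + y (n + 2)) → cfT b k (y (k + 1) / y k) = y 1 / y 0 := by
    intro k
    induction k with
    | zero => intro b y _ _; simp [cfT]
    | succ k ih =>
      intro b y hy hrec
      have := ih (fun n => b (n + 1)) (fun n => y (n + 1)) (fun n => hy _) (fun n => hrec _)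
      rw [cfT, this, hrec 0]
      have h1 := hy 1
      have h2 := hy 2
      simp only [zero_add, Nat.reduceAdd]
      have h3 : b 0 * y 1 + y 2 ≠ 0 := by have := hrec 0; have := hy 0; simp at *; linarith
      field_simp
  have hle : ∀ k, y (k + 1) / y k ≤ 1 / c := by
    intro k
    rw [div_le_div_iff₀ (hy _) hc]
    nlinarith [hrec k, hy (k + 2), mul_le_mul_of_nonneg_right (hb k) (hy (k + 1)).le]
  have ht : Tendsto (fun k => cfT b k 0) atTop (nhds (y 1 / y 0)) := by
    rw [tendsto_iff_dist_tendsto_zero]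
    refine squeeze_zero (fun _ => dist_nonneg) (fun k => ?_)
      (rate_tendsto c hc (1 + 1 / (c ^ 2 * rr c)) (1 / c))
    rw [← key k b y hy hrec, Real.dist_eq]
    have h0 : 0 ≤ y (k + 1) / y k := (div_pos (hy _) (hy _)).le
    refine (cfT_contr c hc k b _ _ hb le_rfl h0).trans ?_
    have := rr_pos c
    gcongr
    rw [zero_sub, abs_neg, abs_of_nonneg h0]
    exact hle k
  rw [tendsto_nhds_unique hL ht, div_mul_cancel₀ _ (hy 0).ne']

theorem cfT_exists (c : ℝ) (hc : 0 < c) (b : ℕ → ℝ) (hb : ∀ n, c ≤ b n) :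
    ∃ y : ℕ → ℝ, (∀ n, 0 < y n) ∧ (∀ n, y n = b n * y (n + 1) + y (n + 2)) ∧ y 0 = 1 ∧
      ∃ A, 0 ≤ A ∧ ∀ n, y n ≤ A * rr c ^ n := by
  have hconv := fun m : ℕ => cfT_conv c hc (fun n => b (n + m)) (fun n => hb _)
  choose L hL using hconv
  have hL0 : ∀ m, 0 ≤ L m := fun m => ge_of_tendsto' (hL m)
    (fun k => cfT_nonneg k _ 0 (fun n => hc.trans_le (hb _)) le_rfl)
  have hbp : ∀ n, 0 < b n := fun n => hc.trans_le (hb n)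
  have hLrec : ∀ m, L m = 1 / (b m + L (m + 1)) := by
    intro m
    have h1 := (hL m).comp (tendsto_add_atTop_nat 1)
    have h2 : Tendsto (fun k => 1 / (b m + cfT (fun n => b (n + (m + 1))) k 0)) atTop
        (nhds (1 / (b m + L (m + 1)))) := by
      apply Tendsto.div tendsto_const_nhds ((hL (m + 1)).const_add _)
      have := hbp m; have := hL0 (m + 1); positivity
    refine tendsto_nhds_unique h1 (h2.congr fun k => ?_)
    simp only [Function.comp, cfT, zero_add]
    congr 4
    funext n
    congr 1
    ring
  have hLp : ∀ m, 0 < L m := by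
    intro m; rw [hLrec]; have := hbp m; have := hL0 (m + 1); positivity
  let y : ℕ → ℝ := fun n => ∏ i ∈ Finset.range n, L i
  have hy : ∀ n, 0 < y n := fun n => Finset.prod_pos fun i _ => hLp i
  have hs : ∀ n, y (n + 1) = y n * L n := fun n => Finset.prod_range_succ _ _
  have hrec : ∀ n, y n = b n * y (n + 1) + y (n + 2) := by
    intro n
    have e : L n * (b n + L (n + 1)) = 1 := by
      have := hbp n; have := hL0 (n + 1)
      rw [hLrec n]; field_simp
    rw [show n + 2 = (n + 1) + 1 from rfl, hs (n + 1), hs n]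
    linear_combination (-y n) * e
  have hr := rr_pos c
  refine ⟨y, hy, hrec, by simp [y], y 0 + y 1 / rr c, ?_, ?_⟩
  · have := hy 0; have := hy 1; positivity
  intro n
  induction n using Nat.twoStepInduction with
  | zero =>
    have : 0 ≤ y 1 / rr c := (div_pos (hy 1) hr).le
    simp only [pow_zero]; linarith
  | one =>
    have e : (y 0 + y 1 / rr c) * rr c ^ 1 = y 0 * rr c + y 1 := by field_simp
    rw [e]; have := mul_pos (hy 0) hr; linarith
  | more n ih _ =>
    have h : y (n + 2) ≤ rr c ^ 2 * y n := by
      rw [rr_sq, one_div, ← div_eq_inv_mul, le_div_iff₀ (by positivity)]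
      have h1 := hrec n
      have h2 := hrec (n + 1)
      have h3 : c * y (n + 2) ≤ y (n + 1) := by
        have := mul_le_mul_of_nonneg_right (hb (n + 1)) (hy (n + 2)).le
        have := hy (n + 3)
        simp only [add_assoc, Nat.reduceAdd] at *
        linarith
      have h4 := mul_le_mul (hb n) h3 (mul_pos hc (hy _)).le (hbp n).le
      nlinarith
    calc y (n + 2) ≤ rr c ^ 2 * y n := h
      _ ≤ rr c ^ 2 * ((y 0 + y 1 / rr c) * rr c ^ n) := by gcongr
      _ = _ := by ring

theorem summ_aux (c : ℝ) (hc : 0 < c) (s B : ℝ) (v : ℕ → ℝ)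
    (hv : ∀ n, 1 ≤ n → |v n| ≤ B * rr c ^ n) :
    Summable fun n : ℕ => (1 + (n : ℝ) ^ (2 * s)) * (v n) ^ 2 := by
  have hr := rr_pos c
  have hr2 : ‖rr c ^ 2‖ < 1 := by
    rw [Real.norm_of_nonneg (by positivity)]
    exact pow_lt_one₀ hr.le (rr_lt c hc) (by norm_num)
  obtain ⟨K, hK⟩ := exists_nat_ge (2 * s)
  have hS := ((summable_pow_mul_geometric_of_norm_lt_one 0 hr2).add
    (summable_pow_mul_geometric_of_norm_lt_one K hr2)).mul_left (B ^ 2)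
  refine Summable.of_norm_bounded_eventually_nat hS ?_
  filter_upwards [eventually_ge_atTop 1] with n hn
  have hn' : (1 : ℝ) ≤ n := by exact_mod_cast hn
  have h1 : (n : ℝ) ^ (2 * s) ≤ (n : ℝ) ^ K := by
    rw [← Real.rpow_natCast]
    exact Real.rpow_le_rpow_of_exponent_le hn' hK
  have h2 : v n ^ 2 ≤ (B * rr c ^ n) ^ 2 := by
    rw [← sq_abs (v n)]
    exact pow_le_pow_left₀ (abs_nonneg _) (hv n hn) 2
  rw [Real.norm_of_nonneg (by positivity)]
  calc _ ≤ (1 + (n : ℝ) ^ K) * (B * rr c ^ n) ^ 2 := by gcongr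
    _ = _ := by simp only [pow_zero]; ring

theorem nsq_nonneg (v : ℤ × ℤ) : 0 ≤ nsq v := by unfold nsq; positivity

theorem rho_pos (p q : ℤ × ℤ) (hI0 : typeI0 p q) (n : ℤ) (hn : n ≠ 0) :
    0 < rho p q n ∧ rho p q n ≤ 1 := by
  have h := hI0.2 n hn
  have h0 := nsq_nonneg p
  have hN : 0 < nsq (pt q p n) := h0.trans_lt h
  unfold rho
  constructor
  · rw [sub_pos, div_lt_one hN]; exact h
  · have := div_nonneg h0 hN.le; linarith

theorem rho_zero_neg (p q : ℤ × ℤ) (hpq : wedge p q ≠ 0) (hI0 : typeI0 p q) :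
    rho p q 0 < 0 := by
  have hq : 0 < nsq q := by
    rcases (nsq_nonneg q).lt_or_eq with h | h
    · exact h
    · exfalso
      apply hpq
      unfold nsq at h
      have h1 : (q.1 : ℝ) = 0 := by nlinarith [sq_nonneg (q.1 : ℝ), sq_nonneg (q.2 : ℝ)]
      have h2 : (q.2 : ℝ) = 0 := by nlinarith [sq_nonneg (q.1 : ℝ), sq_nonneg (q.2 : ℝ)]
      have h1' : q.1 = 0 := by exact_mod_cast h1
      have h2' : q.2 = 0 := by exact_mod_cast h2
      simp [wedge, h1', h2']
  have e : pt q p 0 = q := by simp [pt]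
  unfold rho
  rw [e, sub_neg, one_lt_div hq]
  exact hI0.1

theorem rho_ne (p q : ℤ × ℤ) (hpq : wedge p q ≠ 0) (hI0 : typeI0 p q) (n : ℤ) :
    rho p q n ≠ 0 := by
  by_cases h : n = 0
  · subst h; exact (rho_zero_neg p q hpq hI0).ne
  · exact (rho_pos p q hI0 n h).1.ne'

theorem acoef_ge (p q : ℤ × ℤ) (hI0 : typeI0 p q) (ν lam : ℝ) (hν : 0 < ν)
    (hlam : 0 < lam) (n : ℤ) (hn : n ≠ 0) : lam ≤ acoef p q lam ν n := by
  obtain ⟨h1, h2⟩ := rho_pos p q hI0 n hn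
  unfold acoef
  rw [le_div_iff₀ h1]
  nlinarith [mul_nonneg hν.le (nsq_nonneg (pt q p n))]

theorem acoef_mul (p q : ℤ × ℤ) (hpq : wedge p q ≠ 0) (hI0 : typeI0 p q) (ν lam : ℝ) (n : ℤ) :
    acoef p q lam ν n * rho p q n = lam + ν * nsq (pt q p n) :=
  div_mul_cancel₀ _ (rho_ne p q hpq hI0 n)

theorem forward (p q : ℤ × ℤ) (hpq : wedge p q ≠ 0) (hI0 : typeI0 p q) (ν lam : ℝ)
    (hν : 0 < ν) (hlam : 0 < lam) (F G : ℝ)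
    (hF : Tendsto (fun k => cfT (fun j : ℕ => acoef p q lam ν (1 + (j : ℤ))) k 0) atTop (nhds F))
    (hG : Tendsto (fun k => cfT (fun j : ℕ => acoef p q lam ν (-1 - (j : ℤ))) k 0) atTop (nhds G))
    (w : ℤ → ℝ)
    (hw : ∀ n : ℤ, rho p q (n - 1) * w (n - 1) - rho p q (n + 1) * w (n + 1)
            - ν * nsq (pt q p n) * w n = lam * w n) (hs : signI0 w) :
    acoef p q lam ν 0 + F + G = 0 := by
  obtain ⟨s1, s2, s3, s4⟩ := hs
  have hz : ∀ n : ℤ, rho p q (n - 1) * w (n - 1) =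
      acoef p q lam ν n * (rho p q n * w n) + rho p q (n + 1) * w (n + 1) := by
    intro n
    have h1 := hw n
    have h2 := acoef_mul p q hpq hI0 ν lam n
    linear_combination h1 - w n * h2
  have hρ0 := rho_zero_neg p q hpq hI0
  have z0 : 0 < rho p q 0 * w 0 := mul_pos_of_neg_of_neg hρ0 s3
  have A := cfT_unique lam hlam _
    (fun j => acoef_ge p q hI0 ν lam hν hlam (1 + (j : ℤ)) (by omega)) F hF
    (fun n : ℕ => rho p q n * w n)
    (by
      intro n
      rcases Nat.eq_zero_or_pos n with rfl | hn
      · simpa using z0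
      · exact mul_pos (rho_pos p q hI0 n (by omega)).1 (s1 n (by omega)))
    (by
      intro n
      have := hz (1 + n)
      rw [show (1 + (n : ℤ) - 1) = n by ring] at this
      simp only [Nat.cast_add, Nat.cast_one, Nat.cast_ofNat]
      rw [this, show (1 + (n : ℤ) + 1) = n + 2 by ring, add_comm 1 (n : ℤ)])
  have B := cfT_unique lam hlam _
    (fun j => acoef_ge p q hI0 ν lam hν hlam (-1 - (j : ℤ)) (by omega)) G hG
    (fun n : ℕ => (-1) ^ n * (rho p q (-n) * w (-n)))
    (by
      intro n
      rcases Nat.eq_zero_or_pos n with rfl | hn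
      · simpa using z0
      · have hr := (rho_pos p q hI0 (-n) (by omega)).1
        have : 0 < (-1) ^ n * w (-n) := by
          rcases Nat.lt_or_ge n 2 with h | h
          · obtain rfl : n = 1 := by omega
            simpa using s2
          · simpa using s4 (-n) (by omega)
        have := mul_pos hr this
        linarith)
    (by
      intro n
      have := hz (-1 - n)
      rw [show (-1 - (n : ℤ) + 1) = -n by ring, show (-1 - (n : ℤ) - 1) = -(n + 2) by ring,
        show -1 - (n : ℤ) = -(n + 1) by ring] at this
      simp only [Nat.cast_add, Nat.cast_one, Nat.cast_ofNat]
      rw [show -1 - (n : ℤ) = -(n + 1) by ring]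
      linear_combination (-1) ^ (n + 1) * this)
  have C := hz 0
  simp only [Nat.cast_one, Nat.cast_zero, neg_zero, pow_zero, pow_one, one_mul] at A B
  simp only [zero_sub, zero_add] at C
  have : (acoef p q lam ν 0 + F + G) * (rho p q 0 * w 0) = 0 := by
    linear_combination -A - B - C
  exact (mul_eq_zero.1 this).resolve_right z0.ne'

theorem backward (p q : ℤ × ℤ) (hpq : wedge p q ≠ 0) (hI0 : typeI0 p q) (ν lam : ℝ)
    (hν : 0 < ν) (hlam : 0 < lam) (F G : ℝ)
    (hF : Tendsto (fun k => cfT (fun j : ℕ => acoef p q lam ν (1 + (j : ℤ))) k 0) atTop (nhds F))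
    (hG : Tendsto (fun k => cfT (fun j : ℕ => acoef p q lam ν (-1 - (j : ℤ))) k 0) atTop (nhds G))
    (h0 : acoef p q lam ν 0 + F + G = 0) :
    ∃ w : ℤ → ℝ, (∀ s : ℝ, 0 ≤ s → memL2s s w) ∧
          (∀ n : ℤ, rho p q (n - 1) * w (n - 1) - rho p q (n + 1) * w (n + 1)
            - ν * nsq (pt q p n) * w n = lam * w n) ∧ signI0 w := by
  have ha : ∀ j : ℕ, lam ≤ acoef p q lam ν (1 + (j : ℤ)) :=
    fun j => acoef_ge p q hI0 ν lam hν hlam (1 + (j : ℤ)) (by omega)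
  have hb : ∀ j : ℕ, lam ≤ acoef p q lam ν (-1 - (j : ℤ)) :=
    fun j => acoef_ge p q hI0 ν lam hν hlam (-1 - (j : ℤ)) (by omega)
  obtain ⟨y, hy, hyr, hy0, A, hA, hyA⟩ := cfT_exists lam hlam _ ha
  obtain ⟨x, hx, hxr, hx0, B, hB, hxB⟩ := cfT_exists lam hlam _ hb
  have hy1 := cfT_unique lam hlam _ ha F hF y hy hyr
  have hx1 := cfT_unique lam hlam _ hb G hG x hx hxr
  let z : ℤ → ℝ := fun n => if 0 ≤ n then y n.natAbs else (-1) ^ n.natAbs * x n.natAbs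
  have zp : ∀ n : ℕ, z n = y n := by intro n; simp [z]
  have zm : ∀ n : ℕ, z (-n) = (-1) ^ n * x n := by
    intro n
    rcases Nat.eq_zero_or_pos n with rfl | hn
    · simp [z, hy0, hx0]
    · have : ¬ (0 ≤ -(n : ℤ)) := by omega
      simp only [z, this, if_false, Int.natAbs_neg, Int.natAbs_natCast]
  have hz : ∀ n : ℤ, z (n - 1) = acoef p q lam ν n * z n + z (n + 1) := by
    intro n
    rcases lt_trichotomy n 0 with hn | rfl | hn
    · obtain ⟨m, rfl⟩ : ∃ m : ℕ, n = -((m + 1 : ℕ) : ℤ) := ⟨n.natAbs - 1, by omega⟩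
      rw [show -((m + 1 : ℕ) : ℤ) - 1 = -((m + 2 : ℕ) : ℤ) by push_cast; ring,
        show -((m + 1 : ℕ) : ℤ) + 1 = -((m : ℕ) : ℤ) by push_cast; ring, zm, zm, zm]
      have := hxr m
      rw [show -1 - (m : ℤ) = -((m + 1 : ℕ) : ℤ) by push_cast; ring] at this
      linear_combination -(-1) ^ m * this
    · have e1 := zm 1
      have e2 := zp 1
      have e3 := zp 0
      simp only [Nat.cast_one, Nat.cast_zero] at e1 e2 e3
      rw [zero_sub, zero_add, e1, e2, e3, hy1, hx1, hy0, hx0]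
      linear_combination -h0
    · obtain ⟨m, rfl⟩ : ∃ m : ℕ, n = ((m + 1 : ℕ) : ℤ) := ⟨n.natAbs - 1, by omega⟩
      rw [show ((m + 1 : ℕ) : ℤ) - 1 = (m : ℤ) by push_cast; ring,
        show ((m + 1 : ℕ) : ℤ) + 1 = ((m + 2 : ℕ) : ℤ) by push_cast; ring, zp, zp, zp]
      have := hyr m
      rw [show 1 + (m : ℤ) = ((m + 1 : ℕ) : ℤ) by push_cast; ring] at this
      exact this
  have hr := rr_pos lam
  -- bound: `|z n| * a_n ≤ C * r ^ (|n|-1)` and `|w n| ≤ |z n| * a_n / lam`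
  have hwb : ∀ n : ℤ, n ≠ 0 → ∀ u C : ℝ, 0 ≤ u → |z n| = u → acoef p q lam ν n * u ≤ C →
      |z n / rho p q n| ≤ C / lam := by
    intro n hn u C hu hzu hC
    have hρ := (rho_pos p q hI0 n hn).1
    rw [abs_div, abs_of_pos hρ, hzu, le_div_iff₀ hlam]
    refine le_trans ?_ hC
    have e : acoef p q lam ν n * u = (u / rho p q n) * (lam + ν * nsq (pt q p n)) := by
      unfold acoef; field_simp
    rw [e]
    have h1 : 0 ≤ u / rho p q n := by positivity
    have h2 : 0 ≤ ν * nsq (pt q p n) := mul_nonneg hν.le (nsq_nonneg _)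
    nlinarith
  refine ⟨fun n => z n / rho p q n, ?_, ?_, ?_, ?_, ?_, ?_⟩
  · intro s _
    unfold memL2s
    apply Summable.of_nat_of_neg
    · have := summ_aux lam hlam s (A / rr lam / lam) (fun n : ℕ => z n / rho p q n) ?_
      · simpa using this
      · intro n hn
        obtain ⟨m, rfl⟩ : ∃ m : ℕ, n = m + 1 := ⟨n - 1, by omega⟩
        refine (hwb _ (by omega) (y (m + 1)) (y m) (hy _).le
          (by rw [zp, abs_of_pos (hy _)]) ?_).trans ?_
        · have := hyr m
          have := hy (m + 2)
          rw [show ((m + 1 : ℕ) : ℤ) = 1 + m by push_cast; ring]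
          linarith
        · calc y m / lam ≤ (A * rr lam ^ m) / lam := by gcongr; exact hyA m
            _ = _ := by rw [pow_succ]; field_simp
    · have := summ_aux lam hlam s (B / rr lam / lam) (fun n : ℕ => z (-n) / rho p q (-n)) ?_
      · simpa using this
      · intro n hn
        obtain ⟨m, rfl⟩ : ∃ m : ℕ, n = m + 1 := ⟨n - 1, by omega⟩
        refine (hwb _ (by omega) (x (m + 1)) (x m) (hx _).le
          (by rw [zm, abs_mul, abs_pow, abs_neg, abs_one, one_pow, one_mul, abs_of_pos (hx _)]) ?_).trans ?_
        · have := hxr m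
          have := hx (m + 2)
          rw [show -((m + 1 : ℕ) : ℤ) = -1 - m by push_cast; ring]
          linarith
        · calc x m / lam ≤ (B * rr lam ^ m) / lam := by gcongr; exact hxB m
            _ = _ := by rw [pow_succ]; field_simp
  · intro n
    have hc : ∀ n, rho p q n * (z n / rho p q n) = z n :=
      fun n => mul_div_cancel₀ _ (rho_ne p q hpq hI0 n)
    have h1 := hz n
    have h2 := acoef_mul p q hpq hI0 ν lam n
    simp only [hc]
    have h3 := hc n
    linear_combination h1 + (z n / rho p q n) * h2 - acoef p q lam ν n * h3
  · intro n hn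
    lift n to ℕ using by omega
    simp only [zp]
    exact div_pos (hy _) (rho_pos p q hI0 n (by omega)).1
  · have e1 := zm 1
    simp only [Nat.cast_one] at e1
    simp only [e1]
    apply div_neg_of_neg_of_pos _ (rho_pos p q hI0 (-1) (by omega)).1
    have := hx 1
    simpa using this
  · have e3 := zp 0
    simp only [Nat.cast_zero] at e3
    simp only [e3]
    exact div_neg_of_pos_of_neg (hy 0) (rho_zero_neg p q hpq hI0)
  · intro n hn
    obtain ⟨m, rfl⟩ : ∃ m : ℕ, n = -(m : ℤ) := ⟨n.natAbs, by omega⟩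
    simp only [zm, Int.natAbs_neg, Int.natAbs_natCast]
    rw [← mul_div_assoc, ← mul_assoc, ← mul_pow]
    norm_num
    exact div_pos (hx _) (rho_pos p q hI0 (-m) (by omega)).1

/-- Characterization of unstable eigenvalues of `L_{B,q}` (type I₀) by the
continued fraction equation `a₀(λ,ν) + f(λ,ν) + g(λ,ν) = 0`. -/
theorem eigenvalue_iff_continuedFraction_typeI0 (p q : ℤ × ℤ)
    (hpq : wedge p q ≠ 0) (hI0 : typeI0 p q) (ν lam : ℝ) (hν : 0 < ν)
    (hlam : 0 < lam) :
    ∃ F G : ℝ,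
      Tendsto (fun k : ℕ =>
          cfL ((List.range k).map fun j => acoef p q lam ν (1 + (j : ℤ))))
        atTop (nhds F) ∧
      Tendsto (fun k : ℕ =>
          cfL ((List.range k).map fun j => acoef p q lam ν (-1 - (j : ℤ))))
        atTop (nhds G) ∧
      ((∃ w : ℤ → ℝ, (∀ s : ℝ, 0 ≤ s → memL2s s w) ∧
          (∀ n : ℤ, rho p q (n - 1) * w (n - 1) - rho p q (n + 1) * w (n + 1)
            - ν * nsq (pt q p n) * w n = lam * w n) ∧
          (signI0 w ∨ signI0 (fun n => -w n))) ↔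
        acoef p q lam ν 0 + F + G = 0) := by
  obtain ⟨F, hF⟩ := cfT_conv lam hlam (fun j : ℕ => acoef p q lam ν (1 + (j : ℤ)))
    (fun j => acoef_ge p q hI0 ν lam hν hlam (1 + (j : ℤ)) (by omega))
  obtain ⟨G, hG⟩ := cfT_conv lam hlam (fun j : ℕ => acoef p q lam ν (-1 - (j : ℤ)))
    (fun j => acoef_ge p q hI0 ν lam hν hlam (-1 - (j : ℤ)) (by omega))
  refine ⟨F, G, ?_, ?_, ?_, ?_⟩
  · refine hF.congr fun k => ?_
    refine (cfL_eq_cfT_cast k (fun j : ℤ => acoef p q lam ν (1 + j)) _ ?_).symm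
    simp [List.map_eq_flatMap]
  · refine hG.congr fun k => ?_
    refine (cfL_eq_cfT_cast k (fun j : ℤ => acoef p q lam ν (-1 - j)) _ ?_).symm
    simp [List.map_eq_flatMap]
  · rintro ⟨w, -, hw, hs | hs⟩
    · exact forward p q hpq hI0 ν lam hν hlam F G hF hG w hw hs
    · refine forward p q hpq hI0 ν lam hν hlam F G hF hG (fun n => -w n) (fun n => ?_) hs
      linear_combination -(hw n)
  · intro h0
    obtain ⟨w, h1, h2, h3⟩ := backward p q hpq hI0 ν lam hν hlam F G hF hG h0
    exact ⟨w, h1, h2, Or.inl h3⟩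
end
end

section
/- Let p, q ∈ ℤ² with p∧q ≠ 0 and suppose q is of type I₋ relative to p. Then there exists ν₀ᵐ > 0 such that for every ν ∈ (0, ν₀ᵐ) there exist λ > 0 and a sequence w:ℤ→ℝ, not identically zero, belonging to ℓ²_s(ℤ) for every s ≥ 0, with w_n = 0 for all n < −1, satisfying ρ_{n−1}w_{n−1} − ρ_{n+1}w_{n+1} − ν‖q+np‖² w_n = λ w_n for all n ∈ ℤ. Moreover, for every such ν and every λ > 0, λ admits an eigenvector satisfying the I₋ sign property if and only if a₀(λ,ν) + f(λ,ν) = 0, where f(λ,ν) = lim_{k→∞}[a₁(λ,ν);…;a_k(λ,ν)]. -/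
open Filter Finset Topology

noncomputable section

/-- `q` is of type I₋ relative to `p`. -/
def typeIm (p q : ℤ × ℤ) : Prop :=
  nsq q < nsq p ∧ nsq (pt q p (-1)) = nsq p ∧
    ∀ n : ℤ, n ≠ 0 → n ≠ -1 → nsq p < nsq (pt q p n)

/-- The I₋ sign pattern for an eigenvector sequence. -/
def signIm (w : ℤ → ℝ) : Prop :=
  (∀ n : ℤ, n < -1 → w n = 0) ∧ w (-1) < 0 ∧ w 0 < 0 ∧
    ∀ n : ℤ, 1 ≤ n → 0 < w n


def TT : (ℕ → ℝ) → ℕ → ℝ → ℝ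
  | _, 0, x => x
  | a, (k+1), x => 1 / (a 0 + TT (fun n => a (n+1)) k x)

lemma cfL_eq_TT (a : ℕ → ℝ) (k : ℕ) : cfL ((List.range k).map a) = TT a k 0 := by
  induction k generalizing a with
  | zero => simp [cfL, TT]
  | succ k ih =>
    rw [List.range_succ_eq_map, List.map_cons, List.map_map, cfL, TT, ← ih]
    rfl

lemma TT_add (a : ℕ → ℝ) (k m : ℕ) (x : ℝ) :
    TT a (k+m) x = TT a k (TT (fun n => a (n+k)) m x) := by
  induction k generalizing a with
  | zero => simp [TT]
  | succ k ih =>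
    rw [show k + 1 + m = (k+m)+1 by ring, TT, TT, ih]
    simp only [add_assoc]

lemma TT_nonneg (a : ℕ → ℝ) (ha : ∀ n, 0 < a n) (k : ℕ) (x : ℝ) (hx : 0 ≤ x) :
    0 ≤ TT a k x := by
  induction k generalizing a with
  | zero => simpa [TT] using hx
  | succ k ih =>
    rw [TT]
    have := ih (fun n => a (n+1)) (fun n => ha _)
    have := ha 0
    positivity

lemma TT_le (a : ℕ → ℝ) (c : ℝ) (hc : 0 < c) (ha : ∀ n, c ≤ a n) (k : ℕ) (x : ℝ)
    (hx : 0 ≤ x) (hx' : x ≤ 1 / c) :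
    TT a k x ≤ 1 / c := by
  cases k with
  | zero => simpa [TT] using hx'
  | succ k =>
    rw [TT]
    have := TT_nonneg (fun n => a (n+1)) (fun n => hc.trans_le (ha _)) k x hx
    have := ha 0
    exact one_div_le_one_div_of_le hc (by linarith)

def sg (c : ℝ) : ℝ := Real.sqrt (1 / (1 + c^2))

lemma sg_sq (c : ℝ) : sg c ^ 2 = 1 / (1 + c^2) := Real.sq_sqrt (by positivity)
lemma sg_pos (c : ℝ) : 0 < sg c := Real.sqrt_pos.2 (by positivity)
lemma sg_lt (c : ℝ) (hc : 0 < c) : sg c < 1 := by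
  have h := sg_sq c
  have h2 : 1 / (1 + c^2) < 1 := by rw [div_lt_one (by positivity)]; nlinarith
  have := sg_pos c
  nlinarith

lemma contr (c a b x y : ℝ) (hc : 0 < c) (ha : c ≤ a) (hb : c ≤ b) (hx : 0 ≤ x) (hy : 0 ≤ y) :
    |1 / (a + 1 / (b + x)) - 1 / (a + 1 / (b + y))| ≤ sg c ^ 2 * |x - y| := by
  have ha0 : 0 < a := hc.trans_le ha
  have hb0 : 0 < b := hc.trans_le hb
  have e : 1 / (a + 1 / (b + x)) - 1 / (a + 1 / (b + y))
      = (1 / ((a * (b + x) + 1) * (a * (b + y) + 1))) * (x - y) := by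
    field_simp
    ring
  rw [e, abs_mul, sg_sq, abs_of_pos (by positivity)]
  apply mul_le_mul_of_nonneg_right _ (abs_nonneg _)
  apply one_div_le_one_div_of_le (by positivity)
  have h1 : c * c ≤ a * b := by gcongr
  have h2 : 1 + c^2 ≤ a * (b + x) + 1 := by nlinarith [mul_nonneg ha0.le hx]
  have h3 : 1 ≤ a * (b + y) + 1 := by nlinarith [mul_nonneg ha0.le (add_nonneg hb0.le hy)]
  nlinarith [sq_nonneg c]

lemma TT_diff (c : ℝ) (hc : 0 < c) (x y : ℝ) (hx : 0 ≤ x) (hx' : x ≤ 1 / c)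
    (hy : 0 ≤ y) (hy' : y ≤ 1 / c) (k : ℕ) : ∀ (a : ℕ → ℝ) (_ : ∀ n, c ≤ a n),
    |TT a k x - TT a k y| ≤ (1 / c / sg c) * sg c ^ k := by
  have hs := sg_pos c
  have hs1 := sg_lt c hc
  induction k using Nat.twoStepInduction with
  | zero =>
    intro a ha
    simp only [TT, pow_zero, mul_one]
    rw [le_div_iff₀ hs]
    have : |x - y| ≤ 1 / c := by rw [abs_le]; constructor <;> linarith
    nlinarith [abs_nonneg (x - y)]
  | one =>
    intro a ha
    have h0 : ∀ n, 0 < a n := fun n => hc.trans_le (ha n)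
    have h1 := TT_nonneg a h0 1 x hx
    have h2 := TT_nonneg a h0 1 y hy
    have h3 := TT_le a c hc ha 1 x hx hx'
    have h4 := TT_le a c hc ha 1 y hy hy'
    rw [pow_one, div_mul_cancel₀ _ hs.ne', abs_le]; constructor <;> linarith
  | more k ih _ =>
    intro a ha
    have h0 : ∀ n, 0 < a n := fun n => hc.trans_le (ha n)
    simp only [TT]
    refine (contr c _ _ _ _ hc (ha _) (ha _) (TT_nonneg _ (fun n => h0 _) k x hx)
      (TT_nonneg _ (fun n => h0 _) k y hy)).trans ?_
    have := ih (fun n => a (n+1+1)) (fun n => ha _)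
    calc _ ≤ sg c ^ 2 * ((1 / c / sg c) * sg c ^ k) := by gcongr
      _ = _ := by ring

def FF (a : ℕ → ℝ) : ℝ := limUnder atTop (fun k => TT a k 0)

lemma FF_tendsto (c : ℝ) (hc : 0 < c) (a : ℕ → ℝ) (ha : ∀ n, c ≤ a n) :
    Tendsto (fun k => TT a k 0) atTop (𝓝 (FF a)) := by
  apply CauchySeq.tendsto_limUnder
  apply cauchySeq_of_le_geometric (sg c) (1 / c / sg c) (sg_lt c hc)
  intro n
  rw [TT_add, Real.dist_eq]
  have h0 : ∀ n, 0 < a n := fun n => hc.trans_le (ha n)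
  exact TT_diff c hc _ _ le_rfl (by positivity) (TT_nonneg _ (fun n => h0 _) _ _ le_rfl)
    (TT_le _ c hc (fun n => ha _) _ _ le_rfl (by positivity)) n a ha

lemma FF_nonneg (c : ℝ) (hc : 0 < c) (a : ℕ → ℝ) (ha : ∀ n, c ≤ a n) : 0 ≤ FF a :=
  ge_of_tendsto' (FF_tendsto c hc a ha)
    (fun k => TT_nonneg a (fun n => hc.trans_le (ha n)) k 0 le_rfl)

lemma FF_le (c : ℝ) (hc : 0 < c) (a : ℕ → ℝ) (ha : ∀ n, c ≤ a n) : FF a ≤ 1 / c :=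
  le_of_tendsto' (FF_tendsto c hc a ha)
    (fun k => TT_le a c hc ha k 0 le_rfl (by positivity))

lemma FF_rec (c : ℝ) (hc : 0 < c) (a : ℕ → ℝ) (ha : ∀ n, c ≤ a n) :
    FF a = 1 / (a 0 + FF (fun n => a (n+1))) := by
  have h1 := (FF_tendsto c hc a ha).comp (tendsto_add_atTop_nat 1)
  have h2 := FF_tendsto c hc (fun n => a (n+1)) (fun n => ha _)
  have h3 := FF_nonneg c hc (fun n => a (n+1)) (fun n => ha _)
  have h4 := ha 0
  refine tendsto_nhds_unique h1 ?_
  exact (tendsto_const_nhds (x := (1:ℝ))).div (tendsto_const_nhds.add h2) (by linarith)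

lemma TT_of_rec (a r : ℕ → ℝ) (hr : ∀ n, r n = 1 / (a n + r (n+1))) (k : ℕ) :
    r 0 = TT a k (r k) := by
  induction k generalizing a r with
  | zero => rfl
  | succ k ih =>
    rw [TT, ← ih (fun n => a (n+1)) (fun n => r (n+1)) (fun n => hr _)]
    exact hr 0

lemma FF_unique (c : ℝ) (hc : 0 < c) (a r : ℕ → ℝ) (ha : ∀ n, c ≤ a n)
    (hr0 : ∀ n, 0 ≤ r n) (hr : ∀ n, r n = 1 / (a n + r (n+1))) : r 0 = FF a := by
  have hr1 : ∀ n, r n ≤ 1 / c := fun n => by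
    rw [hr]; exact one_div_le_one_div_of_le hc (by linarith [ha n, hr0 (n+1)])
  have key : ∀ k, |TT a k 0 - r 0| ≤ (1 / c / sg c) * sg c ^ k := fun k => by
    rw [TT_of_rec a r hr k]
    exact TT_diff c hc _ _ le_rfl (by positivity) (hr0 k) (hr1 k) k a ha
  have ht : Tendsto (fun k => (1 / c / sg c) * sg c ^ k) atTop (𝓝 0) := by
    simpa using (tendsto_pow_atTop_nhds_zero_of_lt_one (sg_pos c).le (sg_lt c hc)).const_mul
      (1 / c / sg c)
  have : Tendsto (fun k => TT a k 0) atTop (𝓝 (r 0)) := by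
    rw [tendsto_iff_norm_sub_tendsto_zero]
    exact squeeze_zero (fun _ => norm_nonneg _) key ht
  exact tendsto_nhds_unique this (FF_tendsto c hc a ha)

lemma FF_err (c : ℝ) (hc : 0 < c) (a : ℕ → ℝ) (ha : ∀ n, c ≤ a n) (k : ℕ) :
    |TT a k 0 - FF a| ≤ (1 / c / sg c) * sg c ^ k := by
  have h := TT_of_rec a (fun n => FF (fun m => a (m + n))) (fun n => by
    have := FF_rec c hc (fun m => a (m+n)) (fun n => ha _)
    simp only [zero_add, add_assoc] at this
    rw [this]; simp only [add_comm 1 n]) k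
  simp only [add_zero] at h
  rw [h]
  exact TT_diff c hc _ _ le_rfl (by positivity) (FF_nonneg c hc _ (fun n => ha _))
    (FF_le c hc _ (fun n => ha _)) k a ha

lemma TT_even_le (k m : ℕ) : ∀ (a : ℕ → ℝ) (_ : ∀ n, 0 < a n),
    TT a (2*k) 0 ≤ TT a (2*k+m) 0 := by
  induction k with
  | zero => intro a ha; simpa [TT] using TT_nonneg a ha m 0 le_rfl
  | succ k ih =>
    intro a ha
    rw [show 2*(k+1) = (2*k)+1+1 by ring, show 2*k+1+1+m = (2*k+m)+1+1 by ring]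
    simp only [TT]
    have h1 := ih (fun n => a (n+1+1)) (fun n => ha _)
    have h2 := TT_nonneg (fun n => a (n+1+1)) (fun n => ha _) (2*k) 0 le_rfl
    have h3 := ha 0
    have h4 := ha (0+1)
    have h5 := h2.trans h1
    have h6 : 0 < a (0+1) + TT (fun n => a (n+1+1)) (2*k+m) 0 := by linarith
    have h7 := one_div_pos.2 h6
    gcongr

lemma FF_ge (c : ℝ) (hc : 0 < c) (a : ℕ → ℝ) (ha : ∀ n, c ≤ a n) (k : ℕ) :
    TT a (2*k) 0 ≤ FF a := by
  have h := (FF_tendsto c hc a ha).comp (tendsto_add_atTop_nat (2*k))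
  refine ge_of_tendsto' h fun m => ?_
  simp only [Function.comp]
  rw [add_comm]
  exact TT_even_le k m a (fun n => hc.trans_le (ha n))

lemma small_nu (k : ℕ) : ∀ (b : ℕ → ℝ) (_ : ∀ n, 1 ≤ b n), ∃ L : ℝ, (k:ℝ) ≤ L ∧
    Tendsto (fun ν : ℝ => TT (fun n => ν * b n) (2*k) 0 / ν) (𝓝[>] 0) (𝓝 L) := by
  induction k with
  | zero => intro b hb; exact ⟨0, by simp, by simp [TT]⟩
  | succ k ih =>
    intro b hb
    obtain ⟨L, hL, h⟩ := ih (fun n => b (n+1+1)) (fun n => hb _)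
    refine ⟨b 1 + L, by push_cast; linarith [hb 1], ?_⟩
    have hid : Tendsto (fun ν : ℝ => ν) (𝓝[>] 0) (𝓝 0) := tendsto_nhdsWithin_of_tendsto_nhds tendsto_id
    have h1 := (tendsto_const_nhds (x := b 1)).add h
    have h2 := h1.div ((((hid.mul hid).mul_const (b 0)).mul h1).add_const 1) (by simp)
    simp only [mul_zero, zero_mul, zero_add, div_one] at h2
    refine h2.congr' ?_
    filter_upwards [self_mem_nhdsWithin] with ν hν
    have hν : 0 < ν := hν
    rw [show 2*(k+1) = (2*k)+1+1 by ring]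
    simp only [TT, Pi.div_apply, zero_add]
    have h5 := TT_nonneg (fun n => ν * b (n+1+1))
      (fun n => mul_pos hν (by linarith [hb (n+1+1)])) (2*k) 0 le_rfl
    have h6 := hb 0
    have h7 := hb 1
    generalize TT (fun n => ν * b (n+1+1)) (2*k) 0 = X at *
    have : 0 < b 0 := by linarith
    have : 0 < b 1 := by linarith
    field_simp
    try ring

lemma TT_cont (A : ℝ → ℕ → ℝ) (s : Set ℝ) (k : ℕ) (hA : ∀ n, ContinuousOn (fun l => A l n) s)
    (hp : ∀ l ∈ s, ∀ n, 0 < A l n) : ContinuousOn (fun l => TT (A l) k 0) s := by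
  induction k generalizing A with
  | zero => simpa [TT] using continuousOn_const
  | succ k ih =>
    simp only [TT]
    refine continuousOn_const.div ((hA 0).add (ih (fun l n => A l (n+1)) (fun n => hA _)
      (fun l hl n => hp l hl _))) fun l hl => ?_
    have := TT_nonneg (fun n => A l (n+1)) (fun n => hp l hl _) k 0 le_rfl
    have := hp l hl 0
    positivity

lemma FF_cont (A : ℝ → ℕ → ℝ) (s : Set ℝ) (c : ℝ) (hc : 0 < c)
    (hA : ∀ n, ContinuousOn (fun l => A l n) s)
    (hp : ∀ l ∈ s, ∀ n, c ≤ A l n) : ContinuousOn (fun l => FF (A l)) s := by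
  have hu : TendstoUniformlyOn (fun k l => TT (A l) k 0) (fun l => FF (A l)) atTop s := by
    rw [Metric.tendstoUniformlyOn_iff]
    intro ε hε
    have ht : Tendsto (fun k => (1 / c / sg c) * sg c ^ k) atTop (𝓝 0) := by
      simpa using (tendsto_pow_atTop_nhds_zero_of_lt_one (sg_pos c).le (sg_lt c hc)).const_mul
        (1 / c / sg c)
    filter_upwards [ht.eventually (gt_mem_nhds hε)] with k hk l hl
    rw [dist_comm, Real.dist_eq]
    exact (FF_err c hc (A l) (hp l hl) k).trans_lt hk
  exact hu.continuousOn (Frequently.of_forall fun k => TT_cont A s k hA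
    (fun l hl n => hc.trans_le (hp l hl n)))

lemma z_decay (c : ℝ) (hc : 0 < c) (a z : ℕ → ℝ) (ha : ∀ n, c ≤ a n) (hz : ∀ n, 0 < z n)
    (hrec : ∀ n, z n = a n * z (n+1) + z (n+2)) :
    ∃ C, 0 < C ∧ ∀ n, z n ≤ C * sg c ^ n := by
  have hs := sg_pos c
  refine ⟨z 0 + z 1 / sg c, by have := hz 0; have := hz 1; positivity, fun n => ?_⟩
  have hstep : ∀ n, z (n+2) ≤ sg c ^ 2 * z n := by
    intro n
    rw [sg_sq, div_mul_eq_mul_div, le_div_iff₀ (by positivity), one_mul]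
    have h1 : c * z (n+2) ≤ z (n+1) := by
      have := hrec (n+1)
      have := mul_le_mul_of_nonneg_right (ha (n+1)) (hz (n+2)).le
      linarith [hz (n+3)]
    have h2 : c * z (n+1) ≤ a n * z (n+1) := mul_le_mul_of_nonneg_right (ha n) (hz (n+1)).le
    have h3 : c * (c * z (n+2)) ≤ c * z (n+1) := by gcongr
    nlinarith [hrec n]
  induction n using Nat.twoStepInduction with
  | zero =>
    have := div_pos (hz 1) hs
    simp only [pow_zero, mul_one]; linarith
  | one =>
    have := mul_pos (hz 0) hs
    rw [pow_one, add_mul, div_mul_cancel₀ _ hs.ne']; linarith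
  | more n ih _ =>
    calc z (n+2) ≤ sg c ^ 2 * z n := hstep n
      _ ≤ sg c ^ 2 * ((z 0 + z 1 / sg c) * sg c ^ n) := by gcongr
      _ = _ := by ring

lemma memL2s_of (w : ℤ → ℝ) (C σ : ℝ) (h0 : 0 ≤ σ) (h1 : σ < 1)
    (hneg : ∀ n : ℤ, n < -1 → w n = 0) (hw : ∀ n : ℕ, |w ((n:ℤ)+1)| ≤ C * σ ^ n)
    (s : ℝ) (hs : 0 ≤ s) : memL2s s w := by
  unfold memL2s
  apply Summable.of_nat_of_neg
  · rw [← summable_nat_add_iff 1]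
    obtain ⟨K, hK⟩ := exists_nat_ge (2*s)
    have hσ : σ^2 < 1 := by nlinarith
    have S1 : Summable fun n : ℕ => ((n:ℝ))^K * (σ^2)^n :=
      summable_pow_mul_geometric_of_norm_lt_one K (by
        rw [Real.norm_of_nonneg (by positivity)]; exact hσ)
    have S0 : Summable fun n : ℕ => (σ^2)^n := summable_geometric_of_lt_one (by positivity) hσ
    have S2 : Summable fun n : ℕ => (C^2 * (1+2^K)) * (σ^2)^n + C^2 * 2^K * ((n:ℝ)^K * (σ^2)^n) :=
      (S0.mul_left _).add (S1.mul_left _)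
    refine Summable.of_nonneg_of_le (fun n => by positivity) (fun n => ?_) S2
    have e1 : (w (((n+1 : ℕ)) : ℤ))^2 ≤ (C * σ^n)^2 := by
      rw [← sq_abs]
      have := hw n
      push_cast
      gcongr
    have e2 : |(((n+1:ℕ):ℤ):ℝ)| ^ (2*s) ≤ 2^K + 2^K * (n:ℝ)^K := by
      have hp : (((n+1:ℕ):ℤ):ℝ) = (n:ℝ)+1 := by push_cast; ring
      rw [hp, abs_of_pos (by positivity)]
      calc ((n:ℝ)+1)^(2*s) ≤ ((n:ℝ)+1)^(K:ℝ) :=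
            Real.rpow_le_rpow_of_exponent_le (by linarith [(Nat.cast_nonneg n : (0:ℝ) ≤ n)]) hK
        _ = ((n:ℝ)+1)^K := Real.rpow_natCast _ _
        _ ≤ _ := by
          rcases Nat.eq_zero_or_pos n with h | h
          · subst h
            have : (1:ℝ) ≤ 2^K := one_le_pow₀ (by norm_num)
            have h2 : (0:ℝ) ≤ 2^K * ((0:ℕ):ℝ)^K := by positivity
            simp only [Nat.cast_zero, zero_add, one_pow] at *
            linarith
          · have : (1:ℝ) ≤ n := by exact_mod_cast h
            calc ((n:ℝ)+1)^K ≤ (2 * (n:ℝ))^K := by gcongr; linarith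
              _ = 2^K * (n:ℝ)^K := mul_pow _ _ _
              _ ≤ _ := by
                have : (0:ℝ) < 2^K := by positivity
                linarith
    calc _ ≤ (1 + (2^K + 2^K * (n:ℝ)^K)) * (C * σ^n)^2 := by gcongr
      _ = _ := by ring
  · apply summable_of_ne_finset_zero (s := Finset.range 2)
    intro n hn
    simp only [Finset.mem_range, not_lt] at hn
    rw [hneg (-(n:ℤ)) (by omega)]
    simp

structure Good (N ρ : ℤ → ℝ) : Prop where
  N1 : ∀ n : ℤ, -1 ≤ n → 1 ≤ N n
  r1 : ∀ n : ℤ, 1 ≤ n → 0 < ρ n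
  r1' : ∀ n : ℤ, 1 ≤ n → ρ n ≤ 1
  r0 : ρ 0 < 0
  rm : ρ (-1) = 0

lemma nsq_int (v : ℤ × ℤ) : nsq v = ((v.1^2+v.2^2 : ℤ) : ℝ) := by
  unfold nsq; push_cast; ring

lemma nsq_ge (v : ℤ × ℤ) (h : 0 < nsq v) : 1 ≤ nsq v := by
  rw [nsq_int] at *
  have : 0 < v.1^2+v.2^2 := by exact_mod_cast h
  exact_mod_cast this

lemma good_of (p q : ℤ × ℤ) (hpq : wedge p q ≠ 0) (hIm : typeIm p q) :
    Good (fun n => nsq (pt q p n)) (rho p q) := by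
  obtain ⟨h1, h2, h3⟩ := hIm
  have hq : 0 < nsq q := by
    by_contra hcon
    apply hpq
    rw [nsq_int] at hcon
    have : q.1^2 + q.2^2 ≤ 0 := by exact_mod_cast not_lt.1 hcon
    have a1 : q.1 = 0 := by nlinarith [sq_nonneg q.1, sq_nonneg q.2]
    have a2 : q.2 = 0 := by nlinarith [sq_nonneg q.1, sq_nonneg q.2]
    simp [wedge, a1, a2]
  have hp : 0 < nsq p := hq.trans h1
  have e0 : pt q p 0 = q := by simp [pt]
  have hN : ∀ n : ℤ, 1 ≤ n → nsq p < nsq (pt q p n) := fun n hn => h3 n (by omega) (by omega)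
  refine ⟨fun n hn => ?_, fun n hn => ?_, fun n hn => ?_, ?_, ?_⟩
  · apply nsq_ge
    rcases lt_trichotomy n 0 with h | h | h
    · rw [show n = -1 by omega, h2]; exact hp
    · rw [h, e0]; exact hq
    · exact hp.trans (hN n (by omega))
  · have := hN n hn
    simp only [rho]
    rw [sub_pos, div_lt_one (hp.trans this)]; exact this
  · have := hN n hn
    have := div_pos hp (hp.trans this)
    simp only [rho]; linarith
  · simp only [rho, e0]
    rw [sub_neg, one_lt_div hq]; exact h1
  · simp only [rho, h2]
    rw [div_self hp.ne', sub_self]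

/-- the coefficients -/
def ac (N ρ : ℤ → ℝ) (lam ν : ℝ) (j : ℕ) : ℝ := (lam + ν * N (1 + (j:ℤ))) / ρ (1 + (j:ℤ))

lemma ac_ge {N ρ : ℤ → ℝ} (g : Good N ρ) (lam ν : ℝ) (hl : 0 ≤ lam) (hν : 0 < ν) (n : ℕ) :
    ν ≤ ac N ρ lam ν n := by
  unfold ac
  have h1 := g.N1 (1 + (n:ℤ)) (by omega)
  have h2 := g.r1 (1 + (n:ℤ)) (by omega)
  have h3 := g.r1' (1 + (n:ℤ)) (by omega)
  rw [le_div_iff₀ h2]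
  nlinarith

lemma forward_s3 {N ρ : ℤ → ℝ} (g : Good N ρ) (lam ν : ℝ) (hl : 0 < lam) (hν : 0 < ν)
    (hF : (lam + ν * N 0) / ρ 0 + FF (ac N ρ lam ν) = 0) :
    ∃ w : ℤ → ℝ, (∀ s : ℝ, 0 ≤ s → memL2s s w) ∧
      (∀ n : ℤ, ρ (n - 1) * w (n - 1) - ρ (n + 1) * w (n + 1) - ν * N n * w n = lam * w n) ∧
      signIm w := by
  have ha := ac_ge g lam ν hl.le hν
  set a := ac N ρ lam ν with hadef
  let G : ℕ → ℝ := fun n => FF (fun m => a (m+n))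
  have hGrec : ∀ n, G n = 1 / (a n + G (n+1)) := fun n => by
    have := FF_rec ν hν (fun m => a (m+n)) (fun n => ha _)
    simp only [zero_add, add_assoc] at this
    simp only [G]
    rw [this]; simp only [add_comm 1 n]
  have hG0 : ∀ n, 0 ≤ G n := fun n => FF_nonneg ν hν _ (fun n => ha _)
  have hGp : ∀ n, 0 < G n := fun n => by
    rw [hGrec]; have := hG0 (n+1); have := hν.trans_le (ha n); positivity
  let z : ℕ → ℝ := fun n => ∏ i ∈ Finset.range n, G i
  have hz : ∀ n, 0 < z n := fun n => Finset.prod_pos fun i _ => hGp i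
  have hzs : ∀ n, z (n+1) = z n * G n := fun n => Finset.prod_range_succ _ _
  have hz0 : z 0 = 1 := by simp [z]
  have hzrec : ∀ n, z n = a n * z (n+1) + z (n+2) := fun n => by
    have h1 : (a n + G (n+1)) * G n = 1 := by
      have := hν.trans_le (ha n)
      have := hGp (n+1)
      rw [hGrec n]; field_simp
    rw [hzs (n+1), hzs n]
    linear_combination (-(z n)) * h1
  obtain ⟨C, hC, hzC⟩ := z_decay ν hν a z ha hz hzrec
  let w : ℤ → ℝ := fun n => if n < -1 then 0 else if n = -1 then -1 / (lam + ν * N (-1))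
    else z n.toNat / ρ n
  have hNpos : ∀ n : ℤ, -1 ≤ n → 0 < lam + ν * N n := fun n hn => by
    have := g.N1 n hn; have : 0 < N n := by linarith
    positivity
  have w1 : ∀ n : ℤ, n < -1 → w n = 0 := fun n hn => by simp [w, hn]
  have w2 : w (-1) = -1 / (lam + ν * N (-1)) := by simp [w]
  have w3 : ∀ n : ℕ, w n = z n / ρ n := fun n => by
    have h1 : ¬ ((n:ℤ) < -1) := by omega
    have h2 : ¬ ((n:ℤ) = -1) := by omega
    simp [w, h1, h2]
  have hρ : ∀ n : ℕ, ρ n ≠ 0 := fun n => by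
    rcases Nat.eq_zero_or_pos n with h | h
    · subst h; exact g.r0.ne
    · exact (g.r1 n (by omega)).ne'
  have w4 : ∀ n : ℕ, ρ n * w n = z n := fun n => by
    rw [w3]; have := hρ n; field_simp
  have w5 : ∀ n : ℕ, (lam + ν * N ((n:ℤ)+1)) * w ((n:ℤ)+1) = a n * z (n+1) := fun n => by
    have := w3 (n+1)
    push_cast at this
    rw [this, hadef, ac, add_comm 1 (n:ℤ)]
    ring
  have w6 : ∀ n : ℕ, 0 < w ((n:ℤ)+1) := fun n => by
    have := w3 (n+1)
    push_cast at this
    rw [this]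
    exact div_pos (hz _) (g.r1 _ (by omega))
  refine ⟨w, memL2s_of w (C/ν) (sg ν) (sg_pos ν).le (sg_lt ν hν) w1 (fun n => ?_), fun n => ?_,
    w1, ?_, ?_, fun n hn => ?_⟩
  · rw [abs_of_pos (w6 n)]
    rw [div_mul_eq_mul_div, le_div_iff₀ hν]
    have h1 := w5 n
    have h2 := hzrec n
    have h3 := hz (n+2)
    have h4 := hzC n
    have h5 := g.N1 ((n:ℤ)+1) (by omega)
    have h6 := w6 n
    have h7 : ν ≤ lam + ν * N ((n:ℤ)+1) := by nlinarith
    have h8 := mul_le_mul_of_nonneg_right h7 h6.le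
    linarith
  · rcases lt_or_ge n (-2) with h | h
    · rw [w1 (n-1) (by omega), w1 n (by omega), w1 (n+1) (by omega)]; simp
    · obtain h | h | h | h : n = -2 ∨ n = -1 ∨ n = 0 ∨ 1 ≤ n := by omega
      · subst h
        norm_num
        rw [w1 (-3) (by omega), w1 (-2) (by omega), g.rm]; simp
      · subst h
        norm_num
        have := w4 0
        simp only [Nat.cast_zero] at this
        rw [w1 (-2) (by omega), this, w2, hz0]
        have := hNpos (-1) le_rfl
        field_simp
        ring
      · subst h
        norm_num
        have h0 := w3 0
        have h1 := w4 1
        simp only [Nat.cast_zero, Nat.cast_one] at h0 h1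
        rw [g.rm, h1, hzs 0, hz0, h0, hz0]
        have : G 0 = FF a := by simp [G]
        rw [this]
        have := g.r0.ne
        have h2 : FF a = - ((lam + ν * N 0) / ρ 0) := by linarith
        rw [h2]; ring
      · obtain ⟨m, rfl⟩ : ∃ m : ℕ, n = (m:ℤ) + 1 := ⟨(n-1).toNat, by omega⟩
        have h1 := w4 m
        have h2 := w4 (m+2)
        have h3 := w5 m
        have h4 := hzrec m
        push_cast at h2
        rw [show (m:ℤ)+1-1 = m by ring, show (m:ℤ)+1+1 = m+2 by ring]
        linear_combination h1 - h2 - h3 + h4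
  · rw [w2]; exact div_neg_of_neg_of_pos (by norm_num) (hNpos _ le_rfl)
  · have h0 := w3 0
    simp only [Nat.cast_zero] at h0
    rw [h0]; exact div_neg_of_pos_of_neg (hz 0) g.r0
  · obtain ⟨m, rfl⟩ : ∃ m : ℕ, n = (m:ℤ) + 1 := ⟨(n-1).toNat, by omega⟩
    exact w6 m

lemma backward_s3 {N ρ : ℤ → ℝ} (g : Good N ρ) (lam ν : ℝ) (hl : 0 < lam) (hν : 0 < ν)
    (w : ℤ → ℝ)
    (he : ∀ n : ℤ, ρ (n - 1) * w (n - 1) - ρ (n + 1) * w (n + 1) - ν * N n * w n = lam * w n)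
    (hsg : signIm w) : (lam + ν * N 0) / ρ 0 + FF (ac N ρ lam ν) = 0 := by
  obtain ⟨-, -, h0, hpos⟩ := hsg
  have ha := ac_ge g lam ν hl.le hν
  set a := ac N ρ lam ν with hadef
  let z : ℕ → ℝ := fun n => ρ n * w n
  have hz : ∀ n, 0 < z n := fun n => by
    rcases Nat.eq_zero_or_pos n with h | h
    · subst h; exact mul_pos_of_neg_of_neg g.r0 h0
    · exact mul_pos (g.r1 n (by omega)) (hpos n (by omega))
  have hzrec : ∀ n, z n = a n * z (n+1) + z (n+2) := fun n => by
    have h1 := he ((n:ℤ)+1)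
    have h2 := (g.r1 (1+(n:ℤ)) (by omega)).ne'
    rw [show (n:ℤ)+1-1 = n by ring, show (n:ℤ)+1+1 = n+2 by ring] at h1
    simp only [z, hadef, ac]
    push_cast
    rw [add_comm (n:ℤ) 1] at *
    field_simp
    linear_combination h1
  have hr := FF_unique ν hν a (fun n => z (n+1) / z n) ha
    (fun n => (div_pos (hz _) (hz _)).le) (fun n => by
      have h1 := hz n
      have h2 := hz (n+1)
      have h3 : z (n+1+1) = z n - a n * z (n+1) := by linarith [hzrec n]
      rw [h3, show a n + (z n - a n * z (n+1)) / z (n+1) = z n / z (n+1) by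
        field_simp; ring, one_div_div])
  rw [← hr]
  have h1 := he 0
  norm_num at h1
  rw [g.rm] at h1
  simp only [z]
  have := g.r0.ne
  have := h0.ne
  push_cast
  norm_num
  field_simp
  linear_combination -h1

lemma exist_root {N ρ : ℤ → ℝ} (g : Good N ρ) : ∃ ν₀ > (0:ℝ), ∀ ν : ℝ, 0 < ν → ν < ν₀ →
    ∃ lam > (0:ℝ), (lam + ν * N 0) / ρ 0 + FF (ac N ρ lam ν) = 0 := by
  obtain ⟨k, hk⟩ := exists_nat_gt (-(N 0 / ρ 0))
  let b : ℕ → ℝ := fun j => N (1 + (j:ℤ)) / ρ (1 + (j:ℤ))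
  have hb : ∀ j, 1 ≤ b j := fun j => by
    have := ac_ge g 0 1 le_rfl one_pos j
    simpa [ac, b] using this
  obtain ⟨L, hL, ht⟩ := small_nu k b hb
  have hev := ht.eventually (lt_mem_nhds (hk.trans_le hL))
  obtain ⟨ν₀, hν₀, hsub⟩ := mem_nhdsGT_iff_exists_Ioo_subset.1 hev
  refine ⟨ν₀, hν₀, fun ν hν hlt => ?_⟩
  have hlow : -(N 0 / ρ 0) < TT (fun n => ν * b n) (2*k) 0 / ν := hsub ⟨hν, hlt⟩
  have hab : ac N ρ 0 ν = fun n => ν * b n := by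
    funext n; simp only [ac, b]; ring
  have h0 : 0 < (0 + ν * N 0) / ρ 0 + FF (ac N ρ 0 ν) := by
    have := FF_ge ν hν (ac N ρ 0 ν) (ac_ge g 0 ν le_rfl hν) k
    rw [lt_div_iff₀ hν] at hlow
    rw [hab] at this ⊢
    have e : (0 + ν * N 0) / ρ 0 = N 0 / ρ 0 * ν := by ring
    rw [e]; linarith
  have hr0 := g.r0
  have hM : 0 ≤ -ρ 0 / ν := (div_pos (by linarith) hν).le
  have h1 : (-ρ 0 / ν + ν * N 0) / ρ 0 + FF (ac N ρ (-ρ 0 / ν) ν) ≤ 0 := by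
    have h2 := FF_le ν hν _ (ac_ge g (-ρ 0 / ν) ν hM hν)
    have h3 : (-ρ 0 / ν + ν * N 0) / ρ 0 = -(1/ν) + ν * N 0 / ρ 0 := by
      have := hr0.ne
      field_simp
    have h4 : ν * N 0 / ρ 0 ≤ 0 :=
      div_nonpos_of_nonneg_of_nonpos (mul_nonneg hν.le (by linarith [g.N1 0 (by norm_num)])) hr0.le
    linarith
  have hcont : ContinuousOn (fun l => (l + ν * N 0) / ρ 0 + FF (ac N ρ l ν))
      (Set.Icc 0 (-ρ 0 / ν)) := by
    apply ContinuousOn.add (by fun_prop)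
    apply FF_cont (fun l => ac N ρ l ν) _ ν hν
    · intro n; simp only [ac]; fun_prop
    · intro l hl n; exact ac_ge g l ν hl.1 hν n
  obtain ⟨l, hl, hl0⟩ := intermediate_value_Icc' hM hcont ⟨h1, h0.le⟩
  refine ⟨l, lt_of_le_of_ne hl.1 ?_, hl0⟩
  rintro rfl
  simp only at hl0
  linarith

/-- Instability of unidirectional flows of type I₋ for 2D Navier-Stokes, and the
characterization of unstable eigenvalues by `a₀(λ,ν) + f(λ,ν) = 0`. -/
theorem instability_NavierStokes_typeIminus (p q : ℤ × ℤ) (hpq : wedge p q ≠ 0)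
    (hIm : typeIm p q) :
    ∃ ν₀ > (0 : ℝ), ∀ ν : ℝ, 0 < ν → ν < ν₀ →
      (∃ lam > (0 : ℝ), ∃ w : ℤ → ℝ, w ≠ 0 ∧ (∀ s : ℝ, 0 ≤ s → memL2s s w) ∧
        (∀ n : ℤ, n < -1 → w n = 0) ∧
        ∀ n : ℤ, rho p q (n - 1) * w (n - 1) - rho p q (n + 1) * w (n + 1)
          - ν * nsq (pt q p n) * w n = lam * w n) ∧
      (∀ lam : ℝ, 0 < lam →
        ∃ F : ℝ,
          Tendsto (fun k : ℕ =>
              cfL ((List.range k).map fun j => acoef p q lam ν (1 + (j : ℤ))))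
            atTop (nhds F) ∧
          ((∃ w : ℤ → ℝ, (∀ s : ℝ, 0 ≤ s → memL2s s w) ∧
              (∀ n : ℤ, rho p q (n - 1) * w (n - 1) - rho p q (n + 1) * w (n + 1)
                - ν * nsq (pt q p n) * w n = lam * w n) ∧
              (signIm w ∨ signIm (fun n => -w n))) ↔
            acoef p q lam ν 0 + F = 0)) := by
  have g := good_of p q hpq hIm
  obtain ⟨ν₀, hν₀, H⟩ := exist_root g
  refine ⟨ν₀, hν₀, fun ν hν hlt => ⟨?_, fun lam hl => ?_⟩⟩
  · obtain ⟨lam, hl, hF⟩ := H ν hν hlt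
    obtain ⟨w, hm, he, hs⟩ := forward_s3 g lam ν hl hν hF
    refine ⟨lam, hl, w, fun h => ?_, hm, hs.1, he⟩
    have := hs.2.1
    rw [h] at this
    simp at this
  · refine ⟨FF (ac (fun n => nsq (pt q p n)) (rho p q) lam ν), ?_, ?_, fun hF => ?_⟩
    · have := FF_tendsto ν hν _ (ac_ge g lam ν hl.le hν)
      refine this.congr fun k => ?_
      rw [← cfL_eq_TT]
      have e : (do let a ← List.range k; pure (a:ℤ) : List ℤ) = (List.range k).map (fun a : ℕ => (a:ℤ)) := by
        simp [← List.map_eq_flatMap]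
      rw [e, List.map_map]
      rfl
    · rintro ⟨w, -, he, hs | hs⟩
      · exact backward_s3 g lam ν hl hν w he hs
      · refine backward_s3 g lam ν hl hν _ (fun n => ?_) hs
        linear_combination -(he n)
    · obtain ⟨w, hm, he, hs⟩ := forward_s3 g lam ν hl hν hF
      exact ⟨w, hm, he, Or.inl hs⟩
end
end

section
/- Let p, q ∈ ℤ² with p∧q ≠ 0 and suppose q is of type I₀ relative to p, and fix ν > 0. Then for every λ ≥ 0 the limits f(λ,ν) = lim_{k→∞}[a₁(λ,ν);…;a_k(λ,ν)] and g(λ,ν) = lim_{k→∞}[a_{−1}(λ,ν);…;a_{−k}(λ,ν)] exist, and f(λ,ν) → f(0,ν) and g(λ,ν) → g(0,ν) as λ → 0⁺. -/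
open Filter Finset Topology

noncomputable section

lemma cfL_nonneg (l : List ℝ) (h : ∀ x ∈ l, 0 ≤ x) : 0 ≤ cfL l := by
  induction l with
  | nil => simp [cfL]
  | cons x xs ih =>
    have h1 := h x (by simp)
    have h2 := ih (fun y hy => h y (by simp [hy]))
    simp only [cfL]
    positivity

def cfC (a : ℕ → ℝ) (k : ℕ) : ℝ := cfL ((List.range k).map a)

lemma cfC_zero (a : ℕ → ℝ) : cfC a 0 = 0 := by simp [cfC, cfL]

lemma cfC_succ (a : ℕ → ℝ) (k : ℕ) :
    cfC a (k + 1) = 1 / (a 0 + cfC (fun n => a (n + 1)) k) := by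
  simp [cfC, cfL, List.range_succ_eq_map, Function.comp_def]

lemma cfC_nonneg (a : ℕ → ℝ) (h : ∀ n, 0 ≤ a n) (k : ℕ) : 0 ≤ cfC a k := by
  apply cfL_nonneg
  intro x hx
  simp only [List.mem_map] at hx
  obtain ⟨j, _, rfl⟩ := hx
  exact h j

lemma inv_contr (a x y : ℝ) (ha : 2 ≤ a) (hx : 0 ≤ x) (hy : 0 ≤ y) :
    |1 / (a + x) - 1 / (a + y)| ≤ |x - y| * (1 / 4) := by
  have h1 : 0 < a + x := by linarith
  have h2 : 0 < a + y := by linarith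
  have e : 1 / (a + x) - 1 / (a + y) = (y - x) * (1 / ((a + x) * (a + y))) := by
    field_simp
    ring
  have h4 : 4 ≤ (a + x) * (a + y) := by nlinarith
  rw [e, abs_mul, abs_sub_comm y x, abs_of_pos (a := 1 / ((a + x) * (a + y))) (by positivity)]
  gcongr

lemma cfC_geom (k : ℕ) : ∀ a : ℕ → ℝ, (∀ n, 2 ≤ a n) →
    dist (cfC a k) (cfC a (k + 1)) ≤ 1 * (1 / 4 : ℝ) ^ k := by
  induction k with
  | zero =>
    intro a ha
    have h0 := ha 0
    rw [cfC_succ, cfC_zero, cfC_zero, Real.dist_eq, add_zero, zero_sub, abs_neg,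
      abs_of_nonneg (by positivity)]
    rw [pow_zero, div_le_iff₀ (by linarith)]
    linarith
  | succ k ih =>
    intro a ha
    have hs : ∀ n, 0 ≤ a (n + 1) := fun n => by linarith [ha (n + 1)]
    have := ih (fun n => a (n + 1)) (fun n => ha _)
    rw [Real.dist_eq] at this
    rw [cfC_succ a k, cfC_succ a (k + 1), Real.dist_eq]
    refine (inv_contr _ _ _ (ha 0) (cfC_nonneg _ hs _) (cfC_nonneg _ hs _)).trans ?_
    rw [pow_succ]
    linarith

lemma cfC_cont (k : ℕ) : ∀ a : ℝ → ℕ → ℝ,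
    (∀ n, ContinuousOn (fun l => a l n) (Set.Ici 0)) → (∀ l, 0 ≤ l → ∀ n, 0 < a l n) →
    ContinuousOn (fun l => cfC (a l) k) (Set.Ici 0) := by
  induction k with
  | zero => intro a _ _; simp only [cfC_zero]; exact continuousOn_const
  | succ k ih =>
    intro a hc hp
    simp only [cfC_succ]
    refine ContinuousOn.div continuousOn_const ((hc 0).add
      (ih (fun l n => a l (n + 1)) (fun n => hc _) (fun l hl n => hp l hl _))) ?_
    intro l hl
    have := cfC_nonneg (fun n => a l (n + 1)) (fun n => (hp l hl _).le) k
    linarith [hp l hl 0]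

lemma cf_main (N : ℕ) : ∀ a : ℝ → ℕ → ℝ,
    (∀ n, ContinuousOn (fun l => a l n) (Set.Ici 0)) → (∀ l, 0 ≤ l → ∀ n, 0 < a l n) →
    (∀ l, 0 ≤ l → ∀ n, N ≤ n → 2 ≤ a l n) →
    ∃ F : ℝ → ℝ, (∀ l, 0 ≤ l → Tendsto (fun k => cfC (a l) k) atTop (nhds (F l))) ∧
      ContinuousOn F (Set.Ici 0) := by
  induction N with
  | zero =>
    intro a hc hp h2
    have hg : ∀ l, 0 ≤ l → ∀ k, dist (cfC (a l) k) (cfC (a l) (k + 1)) ≤ 1 * (1 / 4 : ℝ) ^ k :=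
      fun l hl k => cfC_geom k _ (fun n => h2 l hl n (Nat.zero_le _))
    have hex : ∀ l, ∃ y, 0 ≤ l → Tendsto (fun k => cfC (a l) k) atTop (nhds y) := by
      intro l
      by_cases hl : 0 ≤ l
      · obtain ⟨y, hy⟩ := cauchySeq_tendsto_of_complete
          (cauchySeq_of_le_geometric _ _ (by norm_num) (hg l hl))
        exact ⟨y, fun _ => hy⟩
      · exact ⟨0, fun h => absurd h hl⟩
    choose F hF using hex
    refine ⟨F, hF, ?_⟩
    have hu : TendstoUniformlyOn (fun k l => cfC (a l) k) F atTop (Set.Ici 0) := by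
      rw [Metric.tendstoUniformlyOn_iff]
      intro ε hε
      have ht : Tendsto (fun k : ℕ => 1 * (1 / 4 : ℝ) ^ k / (1 - 1 / 4)) atTop (nhds 0) := by
        have := tendsto_pow_atTop_nhds_zero_of_lt_one (r := (1 / 4 : ℝ)) (by norm_num) (by norm_num)
        simpa using (this.const_mul 1).div_const (1 - 1 / 4)
      filter_upwards [ht.eventually (gt_mem_nhds hε)] with k hk l hl
      rw [dist_comm]
      exact (dist_le_of_le_geometric_of_tendsto _ _ (by norm_num) (hg l hl) (hF l hl) k).trans_lt hk
    exact hu.continuousOn (Frequently.of_forall fun k => cfC_cont k a hc hp)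
  | succ N ih =>
    intro a hc hp h2
    obtain ⟨F, hF, hFc⟩ := ih (fun l n => a l (n + 1)) (fun n => hc _) (fun l hl n => hp l hl _)
      (fun l hl n hn => h2 l hl _ (by omega))
    have hpos : ∀ l, 0 ≤ l → 0 < a l 0 + F l := by
      intro l hl
      have : 0 ≤ F l := ge_of_tendsto' (hF l hl)
        (fun k => cfC_nonneg _ (fun n => (hp l hl _).le) k)
      linarith [hp l hl 0]
    refine ⟨fun l => 1 / (a l 0 + F l), ?_, ?_⟩
    · intro l hl
      rw [← tendsto_add_atTop_iff_nat 1]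
      simp only [cfC_succ]
      exact tendsto_const_nhds.div ((hF l hl).const_add _) (hpos l hl).ne'
    · exact ContinuousOn.div continuousOn_const ((hc 0).add hFc) (fun l hl => (hpos l hl).ne')

lemma nsq_lower (p q : ℤ × ℤ) (hI0 : typeI0 p q) (n : ℤ) (hn : 3 ≤ |n|) :
    (|n| : ℝ) ≤ nsq (pt q p n) := by
  obtain ⟨h, -⟩ := hI0
  have hp1 : 1 ≤ nsq p := by
    have h0 : 0 ≤ nsq q := by unfold nsq; positivity
    have h1 : 0 < nsq p := by linarith
    unfold nsq at h1 ⊢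
    have h2 : 0 < p.1 ^ 2 + p.2 ^ 2 := by exact_mod_cast h1
    have h3 : 1 ≤ p.1 ^ 2 + p.2 ^ 2 := h2
    exact_mod_cast h3
  have hn' : (3 : ℝ) ≤ |(n : ℝ)| := by exact_mod_cast hn
  have hsq : |(n : ℝ)| ^ 2 = (n : ℝ) ^ 2 := sq_abs _
  set d : ℝ := p.1 * q.1 + p.2 * q.2 with hd
  have hq0 : 0 ≤ nsq q := by unfold nsq; positivity
  have hdd : d ^ 2 ≤ nsq p ^ 2 := by
    have : d ^ 2 ≤ nsq p * nsq q := by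
      simp only [hd, nsq]
      nlinarith [sq_nonneg ((p.1 : ℝ) * q.2 - p.2 * q.1)]
    nlinarith
  have hda : |d| ≤ nsq p := abs_le_of_sq_le_sq hdd (by linarith)
  have e : nsq (pt q p n) = nsq q + 2 * (n * d) + n ^ 2 * nsq p := by
    simp only [nsq, pt, hd]; push_cast; ring
  have h1 : -(|(n : ℝ)| * nsq p) ≤ n * d := by
    have h2 := neg_abs_le ((n : ℝ) * d)
    rw [abs_mul] at h2
    nlinarith [abs_nonneg (n : ℝ)]
  rw [e, ← hsq]
  set m : ℝ := |(n : ℝ)|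
  have : m * 1 ≤ m * (m - 2) * nsq p := by
    have : 1 ≤ (m - 2) * nsq p := by nlinarith
    nlinarith
  nlinarith

lemma cf_apply (p q : ℤ × ℤ) (hI0 : typeI0 p q) (ν : ℝ) (hν : 0 < ν) (e : ℕ → ℤ)
    (he : ∀ j, |e j| = j + 1) :
    ∃ F : ℝ → ℝ, (∀ l, 0 ≤ l →
      Tendsto (fun k => cfC (fun j => acoef p q l ν (e j)) k) atTop (nhds (F l))) ∧
      ContinuousOn F (Set.Ici 0) := by
  have hp0 : 0 ≤ nsq p := by unfold nsq; positivity
  have hne : ∀ j, e j ≠ 0 := by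
    intro j h
    have := he j
    rw [h, abs_zero] at this
    omega
  have hlt : ∀ j, nsq p < nsq (pt q p (e j)) := fun j => hI0.2 _ (hne j)
  have hr : ∀ j, 0 < rho p q (e j) := by
    intro j
    have := hlt j
    unfold rho
    rw [sub_pos, div_lt_one (by linarith)]
    exact this
  have hr1 : ∀ j, rho p q (e j) ≤ 1 := by
    intro j
    have : 0 ≤ nsq p / nsq (pt q p (e j)) := div_nonneg hp0 (hp0.trans (hlt j).le)
    unfold rho
    linarith
  have hb : ∀ l, 0 ≤ l → ∀ j, ν * nsq (pt q p (e j)) ≤ acoef p q l ν (e j) := by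
    intro l hl j
    unfold acoef
    rw [le_div_iff₀ (hr j)]
    have : 0 ≤ ν * nsq (pt q p (e j)) := mul_nonneg hν.le (hp0.trans (hlt j).le)
    nlinarith [hr1 j]
  obtain ⟨M, hM⟩ := exists_nat_gt (2 / ν)
  rw [div_lt_iff₀ hν] at hM
  refine cf_main (M + 2) (fun l j => acoef p q l ν (e j)) ?_ ?_ ?_
  · intro n
    unfold acoef
    fun_prop
  · intro l hl j
    exact (mul_pos hν (hp0.trans_lt (hlt j))).trans_le (hb l hl j)
  · intro l hl j hj
    refine le_trans ?_ (hb l hl j)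
    have h1 := nsq_lower p q hI0 (e j) (by rw [he]; omega)
    have h2 : |(e j : ℝ)| = j + 1 := by exact_mod_cast he j
    rw [h2] at h1
    have h3 : (M : ℝ) + 2 ≤ j := by exact_mod_cast hj
    nlinarith

/-- The continued fractions `f(λ,ν)` and `g(λ,ν)` exist for all `λ ≥ 0` and
converge to `f(0,ν)` and `g(0,ν)` as `λ → 0⁺`. -/
theorem continuedFraction_continuous_at_zero (p q : ℤ × ℤ)
    (hpq : wedge p q ≠ 0) (hI0 : typeI0 p q) (ν : ℝ) (hν : 0 < ν) :
    ∃ F G : ℝ → ℝ,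
      (∀ lam : ℝ, 0 ≤ lam →
        Tendsto (fun k : ℕ =>
            cfL ((List.range k).map fun j => acoef p q lam ν (1 + (j : ℤ))))
          atTop (nhds (F lam)) ∧
        Tendsto (fun k : ℕ =>
            cfL ((List.range k).map fun j => acoef p q lam ν (-1 - (j : ℤ))))
          atTop (nhds (G lam))) ∧
      Tendsto F (nhdsWithin 0 (Set.Ioi 0)) (nhds (F 0)) ∧
      Tendsto G (nhdsWithin 0 (Set.Ioi 0)) (nhds (G 0)) := by
  obtain ⟨F, hF, hFc⟩ := cf_apply p q hI0 ν hν (fun j => 1 + (j : ℤ))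
    (fun j => by rw [abs_of_nonneg (by omega)]; omega)
  obtain ⟨G, hG, hGc⟩ := cf_apply p q hI0 ν hν (fun j => -1 - (j : ℤ))
    (fun j => by rw [abs_of_nonpos (by omega)]; omega)
  have h0 : (0 : ℝ) ∈ Set.Ici (0 : ℝ) := Set.self_mem_Ici
  have key : ∀ (f : ℤ → ℝ) (k : ℕ),
      cfL (List.map f (do let a ← List.range k; pure (a : ℤ))) = cfC (fun j => f (j : ℤ)) k := by
    intro f k
    simp only [cfC, List.bind_eq_flatMap, List.map_flatMap]
    congr 1
    exact List.flatMap_pure_eq_map (fun j : ℕ => f (j : ℤ)) (List.range k)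
  refine ⟨F, G, fun l hl => ⟨?_, ?_⟩,
    (hFc 0 h0).mono_left (nhdsWithin_mono _ Set.Ioi_subset_Ici_self),
    (hGc 0 h0).mono_left (nhdsWithin_mono _ Set.Ioi_subset_Ici_self)⟩
  · refine (hF l hl).congr fun k => ?_
    exact (key (fun j => acoef p q l ν (1 + j)) k).symm
  · refine (hG l hl).congr fun k => ?_
    exact (key (fun j => acoef p q l ν (-1 - j)) k).symm
end
end

section
/- Let p, q ∈ ℤ² with p∧q ≠ 0 and suppose q is of type I₀ relative to p, and set b_n = ‖q+np‖⁴/(‖q+np‖² − ‖p‖²) for n ≠ 0. Then for every ν > 0 the limits F(ν) = lim_{k→∞}[νb₁; νb₂; …; νb_k] and G(ν) = lim_{k→∞}[νb_{−1}; νb_{−2}; …; νb_{−k}] exist, and there exists ν₀ > 0 such that for every ν ∈ (0, ν₀), F(ν) + G(ν) > ν‖q‖⁴/(‖p‖² − ‖q‖²). -/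
open Filter Finset Topology

noncomputable section

/-- b_n = ‖q+np‖⁴/(‖q+np‖² − ‖p‖²). -/
def bcoef (p q : ℤ × ℤ) (n : ℤ) : ℝ :=
  (nsq (pt q p n)) ^ 2 / (nsq (pt q p n) - nsq p)

def Scf (a : ℕ → ℝ) (k : ℕ) : ℝ := cfL ((List.range k).map a)

lemma cast_list_map (f : ℤ → ℝ) (l : List ℕ) :
    l.map (fun j : ℕ => f (j : ℤ)) = List.map f (do let a ← l; pure (a : ℤ)) := by
  induction l with
  | nil => rfl
  | cons x xs ih => simp_all [List.flatMap_cons, Function.comp_def]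

lemma Scf_zero (a : ℕ → ℝ) : Scf a 0 = 0 := by simp [Scf, cfL]

lemma Scf_succ (a : ℕ → ℝ) (k : ℕ) :
    Scf a (k + 1) = 1 / (a 0 + Scf (fun j => a (j + 1)) k) := by
  simp [Scf, List.range_succ_eq_map, cfL, List.map_map, Function.comp_def]

lemma Scf_nonneg (k : ℕ) : ∀ (a : ℕ → ℝ), (∀ j, 0 < a j) → 0 ≤ Scf a k := by
  induction k with
  | zero => intro a _; rw [Scf_zero]
  | succ k ih =>
    intro a ha
    rw [Scf_succ]
    have := ih (fun j => a (j + 1)) (fun j => ha _)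
    have := ha 0
    positivity

lemma Scf_le {δ : ℝ} (hδ : 0 < δ) (k : ℕ) (a : ℕ → ℝ) (ha : ∀ j, δ ≤ a j) :
    Scf a k ≤ 1 / δ := by
  cases k with
  | zero => rw [Scf_zero]; positivity
  | succ k =>
    rw [Scf_succ]
    have := Scf_nonneg k (fun j => a (j + 1)) (fun j => hδ.trans_le (ha _))
    exact one_div_le_one_div_of_le hδ (by linarith [ha 0])

lemma Scf_two (a : ℕ → ℝ) (ha : ∀ j, 0 < a j) (k : ℕ) :
    Scf a (k + 2) = (a 1 + Scf (fun j => a (j + 2)) k) /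
      (1 + a 0 * (a 1 + Scf (fun j => a (j + 2)) k)) := by
  rw [show k + 2 = (k + 1) + 1 from rfl, Scf_succ, Scf_succ]
  have h := Scf_nonneg k (fun j => a (j + 2)) (fun j => ha _)
  have h0 := ha 0
  have h1 := ha 1
  simp only [zero_add, add_assoc, Nat.reduceAdd]
  set X := Scf (fun j => a (j + 2)) k
  have : 0 < a 1 + X := by positivity
  field_simp
  ring

lemma contract {δ x y X Y : ℝ} (hδ : 0 < δ) (hx : δ ≤ x) (hy : δ ≤ y) (hX : 0 ≤ X) (hY : 0 ≤ Y) :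
    |(y + X) / (1 + x * (y + X)) - (y + Y) / (1 + x * (y + Y))| ≤ (1 / (1 + δ ^ 2)) * |X - Y| := by
  have hx0 : 0 < x := hδ.trans_le hx
  have hy0 : 0 < y := hδ.trans_le hy
  have e : (y + X) / (1 + x * (y + X)) - (y + Y) / (1 + x * (y + Y))
      = (1 / ((1 + x * (y + X)) * (1 + x * (y + Y)))) * (X - Y) := by
    have h1 : 0 < 1 + x * (y + X) := by positivity
    have h2 : 0 < 1 + x * (y + Y) := by positivity
    field_simp
    ring
  rw [e, abs_mul, abs_of_pos (by positivity)]
  apply mul_le_mul_of_nonneg_right _ (abs_nonneg _)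
  apply one_div_le_one_div_of_le (by positivity)
  have h1 : 1 + δ ^ 2 ≤ 1 + x * (y + X) := by nlinarith [mul_nonneg hx0.le hX]
  have h2 : 1 ≤ 1 + x * (y + Y) := by
    have : 0 ≤ x * (y + Y) := by positivity
    linarith
  nlinarith [sq_nonneg δ]

lemma Scf_close {δ : ℝ} (hδ : 0 < δ) (m : ℕ) : ∀ (a : ℕ → ℝ), (∀ j, δ ≤ a j) → ∀ k l : ℕ,
    |Scf a (k + 2 * m) - Scf a (l + 2 * m)| ≤ (1 / (1 + δ ^ 2)) ^ m * (1 / δ) := by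
  induction m with
  | zero =>
    intro a ha k l
    have := Scf_le hδ k a ha
    have := Scf_le hδ l a ha
    have := Scf_nonneg k a (fun j => hδ.trans_le (ha _))
    have := Scf_nonneg l a (fun j => hδ.trans_le (ha _))
    simp only [mul_zero, add_zero, pow_zero, one_mul]
    rw [abs_le]; constructor <;> linarith
  | succ m ih =>
    intro a ha k l
    have hp : ∀ j, 0 < a j := fun j => hδ.trans_le (ha _)
    rw [show k + 2 * (m + 1) = (k + 2 * m) + 2 by ring, show l + 2 * (m + 1) = (l + 2 * m) + 2 by ring,
      Scf_two a hp, Scf_two a hp]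
    refine (contract hδ (ha 0) (ha 1) (Scf_nonneg _ _ fun j => hp _)
      (Scf_nonneg _ _ fun j => hp _)).trans ?_
    rw [pow_succ' (1 / (1 + δ ^ 2)) m, mul_assoc]
    exact mul_le_mul_of_nonneg_left (ih _ (fun j => ha _) k l) (by positivity)

lemma Scf_conv {δ : ℝ} (hδ : 0 < δ) (a : ℕ → ℝ) (ha : ∀ j, δ ≤ a j) :
    ∃ L, Tendsto (Scf a) atTop (nhds L) := by
  apply cauchySeq_tendsto_of_complete
  rw [Metric.cauchySeq_iff]
  intro ε hε
  have hr : 1 / (1 + δ ^ 2) < 1 := by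
    rw [div_lt_one (by positivity)]; nlinarith [sq_pos_of_pos hδ]
  obtain ⟨m, hm⟩ := exists_pow_lt_of_lt_one (show 0 < ε * δ by positivity) hr
  refine ⟨2 * m, fun k hk l hl => ?_⟩
  obtain ⟨k, rfl⟩ := Nat.exists_eq_add_of_le' hk
  obtain ⟨l, rfl⟩ := Nat.exists_eq_add_of_le' hl
  rw [Real.dist_eq]
  refine (Scf_close hδ m a ha k l).trans_lt ?_
  rw [mul_one_div, div_lt_iff₀ hδ]
  exact hm

lemma Scf_even_le (m : ℕ) : ∀ (a : ℕ → ℝ), (∀ j, 0 < a j) → ∀ k : ℕ,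
    Scf a (2 * m) ≤ Scf a (k + 2 * m) := by
  induction m with
  | zero => intro a ha k; simpa [Scf_zero] using Scf_nonneg k a ha
  | succ m ih =>
    intro a ha k
    rw [show k + 2 * (m + 1) = (k + 2 * m) + 2 by ring, show 2 * (m + 1) = 2 * m + 2 by ring,
      Scf_two a ha, Scf_two a ha]
    have h := ih (fun j => a (j + 2)) (fun j => ha _) k
    have h1 := Scf_nonneg (2 * m) (fun j => a (j + 2)) (fun j => ha _)
    have h2 := Scf_nonneg (k + 2 * m) (fun j => a (j + 2)) (fun j => ha _)
    have := ha 0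
    have := ha 1
    rw [div_le_div_iff₀ (by positivity) (by positivity)]
    linarith

lemma Scf_asymp (m : ℕ) : ∀ (b : ℕ → ℝ), (∀ j, 0 < b j) → ∃ L, 0 ≤ L ∧ (0 < m → b (2 * m - 1) ≤ L) ∧
    Tendsto (fun ν : ℝ => Scf (fun j => ν * b j) (2 * m) / ν) (𝓝[>] 0) (nhds L) := by
  induction m with
  | zero => intro b hb; exact ⟨0, le_rfl, by simp, by simp [Scf_zero]⟩
  | succ m ih =>
    intro b hb
    obtain ⟨L, hL, hLm, hT⟩ := ih (fun j => b (j + 2)) (fun j => hb _)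
    refine ⟨b 1 + L, by linarith [hb 1], fun _ => ?_, ?_⟩
    · rcases Nat.eq_zero_or_pos m with rfl | hm
      · simpa using hL
      · have := hLm hm
        rw [show 2 * (m + 1) - 1 = 2 * m - 1 + 2 by omega]
        linarith [hb 1]
    · have hν : Tendsto (fun ν : ℝ => ν) (𝓝[>] 0) (nhds 0) := nhdsWithin_le_nhds
      have h1 := hT.const_add (b 1)
      have h2 := h1.div (((hν.pow 2).mul_const (b 0)).mul h1 |>.const_add 1) (by simp)
      simp only [ne_eq, OfNat.ofNat_ne_zero, not_false_eq_true, zero_pow, zero_mul, add_zero, div_one] at h2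
      refine h2.congr' ?_
      filter_upwards [self_mem_nhdsWithin] with ν hν
      have hν : 0 < ν := hν
      have hp : ∀ j, 0 < ν * b j := fun j => mul_pos hν (hb j)
      rw [show 2 * (m + 1) = 2 * m + 2 by ring, Scf_two _ hp]
      have hX := Scf_nonneg (2 * m) (fun j => ν * b (j + 2)) (fun j => hp _)
      simp only [Pi.div_apply]
      set X := Scf (fun j => ν * b (j + 2)) (2 * m)
      have h0 := hb 0
      have h1 := hb 1
      have e : ν ^ 2 * b 0 * (b 1 + X / ν) = ν * b 0 * (ν * b 1 + X) := by
        field_simp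
      have e2 : b 1 + X / ν = (ν * b 1 + X) / ν := by field_simp
      rw [e, e2, div_right_comm]

lemma bcoef_ge {p q : ℤ × ℤ} (h : typeI0 p q) {n : ℤ} (hn : n ≠ 0) :
    nsq (pt q p n) ≤ bcoef p q n := by
  have h1 := h.2 n hn
  have h0 : 0 ≤ nsq p := by unfold nsq; positivity
  unfold bcoef
  rw [le_div_iff₀ (by linarith)]
  nlinarith

lemma nsq_unbdd {p q : ℤ × ℤ} (hP : 0 < nsq p) (c : ℝ) :
    ∃ m : ℕ, 0 < m ∧ c < nsq (pt q p (1 + ((2 * m - 1 : ℕ) : ℤ))) := by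
  set d : ℝ := p.1 * q.1 + p.2 * q.2 with hd
  obtain ⟨m, hm⟩ := exists_nat_gt ((2 * |d| + |c| + 1) / nsq p)
  rw [div_lt_iff₀ hP] at hm
  have hm0 : 0 < m := by
    rcases Nat.eq_zero_or_pos m with rfl | h
    · have := abs_nonneg d
      have := abs_nonneg c
      simp at hm; linarith
    · exact h
  refine ⟨m, hm0, ?_⟩
  have e : (1 + ((2 * m - 1 : ℕ) : ℤ)) = 2 * (m : ℤ) := by omega
  rw [e]
  have e2 : nsq (pt q p (2 * (m : ℤ))) = nsq q + 2 * m * (2 * m * nsq p + 2 * d) := by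
    simp only [nsq, pt, hd]; push_cast; ring
  have hq : 0 ≤ nsq q := by unfold nsq; positivity
  have hm1 : (1 : ℝ) ≤ m := by exact_mod_cast hm0
  have h3 : |c| + 1 ≤ 2 * m * nsq p + 2 * d := by
    have := neg_abs_le d
    nlinarith [abs_nonneg d, mul_pos (show (0:ℝ) < m by linarith) hP]
  rw [e2]
  have := le_abs_self c
  nlinarith [abs_nonneg c]

/-- For type I₀ points, the continued fractions `F(ν)` and `G(ν)` (at `λ = 0`)
exist and for small `ν` they dominate the line `ν‖q‖⁴/(‖p‖² − ‖q‖²)`. -/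
theorem continuedFractions_dominate_line_typeI0 (p q : ℤ × ℤ)
    (hpq : wedge p q ≠ 0) (hI0 : typeI0 p q) :
    ∃ F G : ℝ → ℝ,
      (∀ ν : ℝ, 0 < ν →
        Tendsto (fun k : ℕ =>
            cfL ((List.range k).map fun j => ν * bcoef p q (1 + (j : ℤ))))
          atTop (nhds (F ν)) ∧
        Tendsto (fun k : ℕ =>
            cfL ((List.range k).map fun j => ν * bcoef p q (-1 - (j : ℤ))))
          atTop (nhds (G ν))) ∧
      ∃ ν₀ > (0 : ℝ), ∀ ν : ℝ, 0 < ν → ν < ν₀ →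
        F ν + G ν > ν * (nsq q) ^ 2 / (nsq p - nsq q) := by
  have hP : 0 < nsq p := by
    have : 0 ≤ nsq q := by unfold nsq; positivity
    linarith [hI0.1]
  have hb : ∀ n : ℤ, n ≠ 0 → nsq p ≤ bcoef p q n := fun n hn =>
    (hI0.2 n hn).le.trans (bcoef_ge hI0 hn)
  have hF : ∀ ν : ℝ, ∃ L, 0 < ν →
      Tendsto (Scf fun j => ν * bcoef p q (1 + (j : ℤ))) atTop (nhds L) := by
    intro ν
    by_cases hν : 0 < ν
    · obtain ⟨L, hL⟩ := Scf_conv (mul_pos hν hP) (fun j => ν * bcoef p q (1 + (j : ℤ)))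
        (fun j => mul_le_mul_of_nonneg_left (hb _ (by omega)) hν.le)
      exact ⟨L, fun _ => hL⟩
    · exact ⟨0, fun h => absurd h hν⟩
  have hG : ∀ ν : ℝ, ∃ L, 0 < ν →
      Tendsto (Scf fun j => ν * bcoef p q (-1 - (j : ℤ))) atTop (nhds L) := by
    intro ν
    by_cases hν : 0 < ν
    · obtain ⟨L, hL⟩ := Scf_conv (mul_pos hν hP) (fun j => ν * bcoef p q (-1 - (j : ℤ)))
        (fun j => mul_le_mul_of_nonneg_left (hb _ (by omega)) hν.le)
      exact ⟨L, fun _ => hL⟩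
    · exact ⟨0, fun h => absurd h hν⟩
  choose F hF using hF
  choose G hG using hG
  refine ⟨F, G, fun ν hν => ⟨(hF ν hν).congr fun k => ?_, (hG ν hν).congr fun k => ?_⟩, ?_⟩
  · exact congrArg cfL (cast_list_map (fun n : ℤ => ν * bcoef p q (1 + n)) _)
  · exact congrArg cfL (cast_list_map (fun n : ℤ => ν * bcoef p q (-1 - n)) _)
  set c : ℝ := (nsq q) ^ 2 / (nsq p - nsq q) with hc
  obtain ⟨m, hm, hcm⟩ := nsq_unbdd (q := q) hP c
  obtain ⟨L, -, hL, hT⟩ := Scf_asymp m (fun j => bcoef p q (1 + (j : ℤ)))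
    (fun j => hP.trans_le (hb _ (by omega)))
  have hcL : c < L := hcm.trans_le ((bcoef_ge hI0 (by omega)).trans (hL hm))
  have hev := hT.eventually (lt_mem_nhds hcL)
  rw [eventually_nhdsWithin_iff, Metric.eventually_nhds_iff] at hev
  obtain ⟨ν₀, hν₀, hev⟩ := hev
  refine ⟨ν₀, hν₀, fun ν hν hlt => ?_⟩
  have h1 := hev (y := ν) (by rw [Real.dist_eq, sub_zero, abs_of_pos hν]; exact hlt) hν
  rw [lt_div_iff₀ hν] at h1
  have h2 : Scf (fun j => ν * bcoef p q (1 + (j : ℤ))) (2 * m) ≤ F ν := by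
    refine ge_of_tendsto (hF ν hν) ?_
    filter_upwards [eventually_ge_atTop (2 * m)] with k hk
    obtain ⟨k, rfl⟩ := Nat.exists_eq_add_of_le' hk
    exact Scf_even_le m _ (fun j => mul_pos hν (hP.trans_le (hb _ (by omega)))) k
  have h3 : 0 ≤ G ν := ge_of_tendsto' (hG ν hν) fun k =>
    Scf_nonneg k _ (fun j => mul_pos hν (hP.trans_le (hb _ (by omega))))
  rw [mul_div_assoc]
  linarith
end
end
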